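/- arXiv:0902.3093 — 2 statements merged into one kernel-verified Lean document; each statement's English description precedes it below -/
import Mathlib

section
/- Let A be an additive basis of order h, and let X be a finite nonempty subset of A such that A \ X is still an additive basis. Set d := diam(X)/δ(X). Then the order of A \ X satisfies G(A \ X) ≤ h(h+3)/2 + d·h(h−1)(h+4)/6. -/
open Pointwise

/-- The `h`-fold sumset of a set `S` of integers:
sums of `h` elements of `S` (with repetitions); `0`-fold sumset is `{0}`. -/
def foldSum (h : ℕ) (S : Set ℤ) : Set ℤ :=
  {z : ℤ | ∃ f : Fin h → ℤ, (∀ i, f i ∈ S) ∧ ∑ i, f i = z}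

/-- Every sufficiently large integer is a sum of `h` elements of `A`. -/
def RepBy (A : Set ℤ) (h : ℕ) : Prop :=
  ∀ᶠ N : ℤ in Filter.atTop, N ∈ foldSum h A

/-- `A ⊆ ℤ` is an additive basis: it has only finitely many negative elements and
there is `h ≥ 1` such that every sufficiently large positive integer is a
sum of `h` elements of `A`. -/
def IsAdditiveBasis (A : Set ℤ) : Prop :=
  {n : ℤ | n ∈ A ∧ n < 0}.Finite ∧ ∃ h : ℕ, 1 ≤ h ∧ RepBy A h

/-- The order `G(A)` of an additive basis: the least `h ≥ 1` such that every
sufficiently large positive integer is a sum of `h` elements of `A`. -/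
noncomputable def basisOrder (A : Set ℤ) : ℕ :=
  sInf {h : ℕ | 1 ≤ h ∧ RepBy A h}

/-- The diameter of a finite set of integers: `max {|x - y| : x, y ∈ X}` (as a natural number). -/
def diamN (X : Finset ℤ) : ℕ :=
  (X ×ˢ X).sup fun p => (p.1 - p.2).natAbs

/-- `δ(X) := gcd {x - y : x, y ∈ X}`, with the convention `δ(X) = 1` when `|X| = 1`. -/
def deltaN (X : Finset ℤ) : ℕ :=
  if 2 ≤ X.card then (X ×ˢ X).gcd (fun p => (p.1 - p.2).natAbs) else 1

theorem fs_succ {h : ℕ} {S : Set ℤ} {z : ℤ} :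
    z ∈ foldSum (h + 1) S ↔ ∃ a ∈ S, ∃ w ∈ foldSum h S, z = a + w := by
  constructor
  · rintro ⟨f, hf, rfl⟩
    exact ⟨f 0, hf 0, ∑ i : Fin h, f i.succ, ⟨fun i => f i.succ, fun i => hf _, rfl⟩,
      Fin.sum_univ_succ f⟩
  · rintro ⟨a, ha, w, ⟨f, hf, rfl⟩, rfl⟩
    refine ⟨Fin.cons a f, fun i => ?_, by simp [Fin.sum_univ_succ]⟩
    refine Fin.cases ?_ (fun j => ?_) i
    · simpa using ha
    · simpa using hf j

theorem fs_zero {S : Set ℤ} {z : ℤ} : z ∈ foldSum 0 S ↔ z = 0 := by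
  constructor
  · rintro ⟨f, hf, rfl⟩
    simp
  · rintro rfl
    exact ⟨fun _ => 0, fun i => i.elim0, by simp⟩

theorem fs_add {S : Set ℤ} {k l : ℕ} {u v : ℤ} (hu : u ∈ foldSum k S) (hv : v ∈ foldSum l S) :
    u + v ∈ foldSum (k + l) S := by
  induction k generalizing u with
  | zero => rw [fs_zero] at hu; subst hu; simpa using hv
  | succ k ih =>
    obtain ⟨a, ha, w, hw, rfl⟩ := fs_succ.1 hu
    rw [show k + 1 + l = (k + l) + 1 by ring]
    exact fs_succ.2 ⟨a, ha, w + v, ih hw, by ring⟩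

theorem fs_one {S : Set ℤ} {b : ℤ} (hb : b ∈ S) : b ∈ foldSum 1 S :=
  fs_succ.2 ⟨b, hb, 0, fs_zero.2 rfl, by simp⟩

theorem fs_le {S : Set ℤ} {M : ℤ} (hM : ∀ b ∈ S, b ≤ M) {k : ℕ} {u : ℤ}
    (hu : u ∈ foldSum k S) : u ≤ k * M := by
  induction k generalizing u with
  | zero => rw [fs_zero] at hu; simp [hu]
  | succ k ih =>
    obtain ⟨a, ha, w, hw, rfl⟩ := fs_succ.1 hu
    have := ih hw
    have := hM a ha
    push_cast
    linarith

/-- Elements of a basis are unbounded above. -/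
theorem basis_unbdd {B : Set ℤ} {H : ℕ} (hH : RepBy B H) (K : ℤ) : ∃ b ∈ B, K ≤ b := by
  by_contra! hc
  obtain ⟨n0, hn0⟩ := Filter.eventually_atTop.1 hH
  have h1 := hn0 (max n0 (H * K + 1)) (le_max_left _ _)
  have h2 := fs_le (fun b hb => (hc b hb).le) h1
  have h3 := le_max_right n0 (H * K + 1)
  linarith

theorem fs_unbdd {B : Set ℤ} (hB : ∀ K : ℤ, ∃ b ∈ B, K ≤ b) {k : ℕ} (hk : 1 ≤ k) (K : ℤ) :
    ∃ u ∈ foldSum k B, K ≤ u := by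
  induction k, hk using Nat.le_induction generalizing K with
  | base => obtain ⟨b, hb, h⟩ := hB K; exact ⟨b, fs_one hb, h⟩
  | succ k hk ih =>
    obtain ⟨b, hb, h⟩ := hB 0
    obtain ⟨u, hu, h'⟩ := ih K
    exact ⟨b + u, fs_succ.2 ⟨b, hb, u, hu, rfl⟩, by linarith⟩

/-- If `F` is closed above `n0` under adding differences of `B`, then it is closed under adding
differences of `H`-fold sums, far enough out. -/
theorem closed_iter {B F : Set ℤ} {n0 : ℤ}
    (hF : ∀ n ∈ F, ∀ a ∈ B, ∀ b ∈ B, n0 ≤ n + a - b → n + a - b ∈ F)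
    {H : ℕ} {u v : ℤ} (hu : u ∈ foldSum H B) (hv : v ∈ foldSum H B) :
    ∃ C : ℤ, ∀ n ∈ F, C ≤ n → n + u - v ∈ F := by
  induction H generalizing u v with
  | zero =>
    rw [fs_zero] at hu hv
    subst hu hv
    exact ⟨0, fun n hn _ => by simpa using hn⟩
  | succ H ih =>
    obtain ⟨a, ha, u', hu', rfl⟩ := fs_succ.1 hu
    obtain ⟨b, hb, v', hv', rfl⟩ := fs_succ.1 hv
    obtain ⟨C, hC⟩ := ih hu' hv'
    refine ⟨max C n0 - a + b, fun n hn hCn => ?_⟩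
    have h1 := le_max_left C n0
    have h2 := le_max_right C n0
    have h3 := hC (n + a - b) (hF n hn a ha b hb (by linarith)) (by linarith)
    rwa [show n + (a + u') - (b + v') = n + a - b + u' - v' by ring]

/-- The merging lemma: a finite cover by translates of `k B` collapses. -/
theorem merge {B : Set ℤ} {H : ℕ} (hH : RepBy B H) (n : ℕ) :
    ∀ s : Multiset (ℕ × ℤ), s.card = n → (∀ p ∈ s, 1 ≤ p.1) →
      (∀ᶠ N : ℤ in Filter.atTop, ∃ p ∈ s, N - p.2 ∈ foldSum p.1 B) →
      ∃ m, 1 ≤ m ∧ m ≤ (s.map fun p => p.1 + 1).sum ∧ RepBy B m := by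
  induction n with
  | zero =>
    intro s hs _ hc
    obtain ⟨N, p, hp, _⟩ := hc.exists
    rw [Multiset.card_eq_zero] at hs
    simp [hs] at hp
  | succ n ih =>
    intro s hs hpos hc
    obtain ⟨⟨k, t⟩, s', rfl⟩ : ∃ p s', s = p ::ₘ s' := by
      obtain ⟨p, hp⟩ := Multiset.card_pos_iff_exists_mem.1 (by omega : 0 < s.card)
      obtain ⟨s', h⟩ := Multiset.exists_cons_of_mem hp
      exact ⟨p, s', h⟩
    by_cases hI : ∃ b ∈ B, ∃ q ∈ s', ∃ c : ℤ,
        c - (t - b) ∈ foldSum (k + 1) B ∧ c - q.2 ∈ foldSum q.1 B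
    · obtain ⟨b, hb, ⟨l, t'⟩, hq, c, hc1, hc2⟩ := hI
      obtain ⟨s'', rfl⟩ := Multiset.exists_cons_of_mem hq
      obtain ⟨m, hm1, hm2, hm⟩ := ih ((k + 1 + l, t - b + t' - c) ::ₘ s'')
        (by simp at hs ⊢; omega)
        (by
          intro p hp
          rcases Multiset.mem_cons.1 hp with rfl | hp
          · simp; omega
          · exact hpos p (by simp [hp]))
        (by
          filter_upwards [hc] with N hN
          obtain ⟨p, hp, hNp⟩ := hN
          rcases Multiset.mem_cons.1 hp with rfl | hp
          · refine ⟨_, Multiset.mem_cons_self _ _, ?_⟩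
            have := fs_add (fs_add hNp (fs_one hb)) hc2
            simp only at this ⊢
            convert this using 1
            ring
          · rcases Multiset.mem_cons.1 hp with rfl | hp
            · refine ⟨_, Multiset.mem_cons_self _ _, ?_⟩
              have := fs_add hc1 hNp
              simp only at this ⊢
              convert this using 1
              ring
            · exact ⟨p, by simp [hp], hNp⟩)
      refine ⟨m, hm1, ?_, hm⟩
      simp only [Multiset.map_cons, Multiset.sum_cons] at hm2 ⊢
      omega
    · push Not at hI
      have hk : 1 ≤ k := hpos (k, t) (by simp)
      refine ⟨k, hk, by simp; omega, ?_⟩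
      obtain ⟨n0, hn0⟩ := Filter.eventually_atTop.1 hc
      have hF : ∀ n ∈ {n : ℤ | n - t ∈ foldSum k B}, ∀ a ∈ B, ∀ b ∈ B, n0 ≤ n + a - b →
          n + a - b ∈ {n : ℤ | n - t ∈ foldSum k B} := by
        intro n hn a ha b hb hle
        obtain ⟨p, hp, hNp⟩ := hn0 _ hle
        rcases Multiset.mem_cons.1 hp with rfl | hp
        · exact hNp
        · refine absurd hNp (hI b hb p hp _ ?_)
          have := fs_add hn (fs_one ha)
          convert this using 1
          ring
      obtain ⟨n1, hn1⟩ := Filter.eventually_atTop.1 hH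
      obtain ⟨C, hC⟩ := closed_iter hF (hn1 (n1 + 1) (by linarith)) (hn1 n1 le_rfl)
      obtain ⟨u, hu, hCu⟩ := fs_unbdd (basis_unbdd hH) hk (C - t)
      refine Filter.eventually_atTop.2 ⟨u, fun N hN => ?_⟩
      induction N, hN using Int.le_induction with
      | base => exact hu
      | succ N hN ih2 =>
        have := hC (N + t) (by simpa using ih2) (by linarith)
        simp only [Set.mem_setOf_eq] at this
        convert this using 1
        ring

/-- Decomposition of an `h`-fold sum of `A` along `X`. -/
theorem fs_split {A : Set ℤ} {X : Finset ℤ} {x0 D : ℤ} {d : ℕ}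
    (hX : ∀ x ∈ X, ∃ j : ℕ, j ≤ d ∧ x = x0 + D * j) {h : ℕ} {z : ℤ} (hz : z ∈ foldSum h A) :
    ∃ k l j : ℕ, k + l = h ∧ j ≤ l * d ∧ z - (l * x0 + D * j) ∈ foldSum k (A \ ↑X) := by
  induction h generalizing z with
  | zero =>
    rw [fs_zero] at hz
    exact ⟨0, 0, 0, rfl, by simp, by simp [fs_zero, hz]⟩
  | succ h ih =>
    obtain ⟨a, ha, w, hw, rfl⟩ := fs_succ.1 hz
    obtain ⟨k, l, j, hkl, hj, hm⟩ := ih hw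
    by_cases haX : a ∈ X
    · obtain ⟨i, hi, rfl⟩ := hX a haX
      refine ⟨k, l + 1, j + i, by omega, by linarith, ?_⟩
      convert hm using 1
      push_cast
      ring
    · refine ⟨k + 1, l, j, by omega, hj, fs_succ.2 ⟨a, ⟨ha, by simpa using haX⟩, _, hm, by ring⟩⟩

theorem exists_param (X : Finset ℤ) (hX : X.Nonempty) :
    ∃ x0 : ℤ, ∀ x ∈ X, ∃ j : ℕ, j ≤ diamN X / deltaN X ∧ x = x0 + (deltaN X : ℤ) * j := by
  refine ⟨X.min' hX, fun x hx => ⟨(x - X.min' hX).natAbs / deltaN X, ?_, ?_⟩⟩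
  · apply Nat.div_le_div_right
    exact Finset.le_sup (f := fun p : ℤ × ℤ => (p.1 - p.2).natAbs) (b := (x, X.min' hX))
      (Finset.mem_product.2 ⟨hx, X.min'_mem hX⟩)
  · have hdvd : deltaN X ∣ (x - X.min' hX).natAbs := by
      unfold deltaN
      split_ifs
      · exact Finset.gcd_dvd (f := fun p : ℤ × ℤ => (p.1 - p.2).natAbs) (b := (x, X.min' hX))
          (Finset.mem_product.2 ⟨hx, X.min'_mem hX⟩)
      · exact one_dvd _
    rw [← Nat.cast_mul, Nat.mul_div_cancel' hdvd]
    have := X.min'_le x hx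
    omega

theorem sum_weights (h d : ℕ) :
    ∑ k ∈ Finset.range h, ((h - (k + 1)) * d + 1) * (k + 1 + 1) =
      h * (h + 3) / 2 + d * (h * (h - 1) * (h + 4)) / 6 := by
  have key : ∀ h : ℕ, (2 * ∑ k ∈ Finset.range h, (k + 2) = h * (h + 3)) ∧
      6 * ∑ k ∈ Finset.range h, (h - (k + 1)) * (k + 2) = h * (h - 1) * (h + 4) := by
    intro h
    induction h with
    | zero => simp
    | succ h ih =>
      obtain ⟨h1, h2⟩ := ih
      refine ⟨by rw [Finset.sum_range_succ, mul_add, h1]; ring, ?_⟩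
      have h3 : ∑ k ∈ Finset.range (h + 1), (h + 1 - (k + 1)) * (k + 2) =
          ∑ k ∈ Finset.range h, (h - (k + 1)) * (k + 2) + ∑ k ∈ Finset.range h, (k + 2) := by
        rw [Finset.sum_range_succ, ← Finset.sum_add_distrib]
        simp only [Nat.sub_self, zero_mul, add_zero]
        refine Finset.sum_congr rfl fun k hk => ?_
        rw [show h + 1 - (k + 1) = h - (k + 1) + 1 by have := Finset.mem_range.1 hk; omega]
        ring
      rw [h3, mul_add, h2, show 6 = 3 * 2 from rfl, mul_assoc 3 2, h1]
      rcases h with _ | h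
      · simp
      · simp only [Nat.add_sub_cancel]
        ring
  obtain ⟨h1, h2⟩ := key h
  rw [← h1, ← h2, Nat.mul_div_cancel_left _ (by norm_num),
    show ∀ S : ℕ, d * (6 * S) = 6 * (d * S) from fun S => by ring,
    Nat.mul_div_cancel_left _ (by norm_num), Finset.mul_sum, ← Finset.sum_add_distrib]
  exact Finset.sum_congr rfl fun k _ => by ring

theorem order_of_basis_minus_subset_le_of_diam_div_delta
    (A : Set ℤ) (h : ℕ) (hA : IsAdditiveBasis A) (hordA : basisOrder A = h)
    (X : Finset ℤ) (hXne : X.Nonempty) (hXA : ↑X ⊆ A)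
    (hB : IsAdditiveBasis (A \ ↑X))
    (d : ℕ) (hd : d = diamN X / deltaN X) :
    basisOrder (A \ ↑X) ≤ h * (h + 3) / 2 + d * (h * (h - 1) * (h + 4)) / 6 := by
  obtain ⟨_, H, _, hH⟩ := hB
  obtain ⟨x0, hx0⟩ := exists_param X hXne
  rw [← hd] at hx0
  have hrep : RepBy A h := by
    have : basisOrder A ∈ {h : ℕ | 1 ≤ h ∧ RepBy A h} := Nat.sInf_mem hA.2
    rw [hordA] at this
    exact this.2
  let I : Finset (Σ _ : ℕ, ℕ) := (Finset.range h).sigma fun k => Finset.range ((h - (k + 1)) * d + 1)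
  let s : Multiset (ℕ × ℤ) := I.val.map fun p =>
    (p.1 + 1, ((h - (p.1 + 1) : ℕ) : ℤ) * x0 + (deltaN X : ℤ) * (p.2 : ℤ))
  obtain ⟨m, hm1, hm2, hm⟩ := merge hH _ s rfl
    (by
      intro p hp
      obtain ⟨q, _, rfl⟩ := Multiset.mem_map.1 hp
      simp)
    (by
      filter_upwards [hrep, Filter.eventually_gt_atTop
        ((h : ℤ) * x0 + (deltaN X : ℤ) * ((h * d : ℕ) : ℤ))] with N hN hlt
      obtain ⟨k, l, j, hkl, hj, hmem⟩ := fs_split hx0 hN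
      rcases k with _ | k
      · exfalso
        rw [fs_zero] at hmem
        have hl : l = h := by omega
        subst hl
        have : (deltaN X : ℤ) * (j : ℤ) ≤ (deltaN X : ℤ) * ((l * d : ℕ) : ℤ) :=
          mul_le_mul_of_nonneg_left (by exact_mod_cast hj) (by positivity)
        linarith
      · have hl : l = h - (k + 1) := by omega
        subst hl
        refine ⟨_, Multiset.mem_map.2 ⟨⟨k, j⟩, ?_, rfl⟩, hmem⟩
        simp only [I, Finset.mem_val, Finset.mem_sigma, Finset.mem_range]
        omega)
  refine (Nat.sInf_le (show m ∈ {h : ℕ | 1 ≤ h ∧ RepBy (A \ ↑X) h} from ⟨hm1, hm⟩)).trans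
    (hm2.trans (le_of_eq ?_))
  rw [← sum_weights]
  simp only [s, Multiset.map_map, Function.comp_def]
  change ∑ p ∈ I, (p.1 + 1 + 1) = _
  simp only [I]
  rw [Finset.sum_sigma]
  simp
end

section
/- Let A be an additive basis of order h, and let X be a finite nonempty subset of A which is an arithmetic progression and such that A \ X is still an additive basis. Then G(A \ X) ≤ h(h+3)/2 + (|X|−1)·h(h−1)(h+4)/6. -/
open Pointwise

/-- A finite set of integers is an arithmetic progression: its elements,
listed in increasing order, have constant consecutive differences. -/
def IsAPFinset (X : Finset ℤ) : Prop :=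
  ∃ a r : ℤ, 0 < r ∧ X = (Finset.range X.card).image (fun i : ℕ => a + (i : ℤ) * r)

section OB


open Set Filter Topology

/-- Translate of a set of integers. -/
def shiftSet (t : ℤ) (U : Set ℤ) : Set ℤ := {x | x + t ∈ U}

/-- Translation invariant finitely additive probability on the integers, vanishing on `Z`. -/
structure IsMean (Z : Set ℤ) (m : Set ℤ → ℝ) : Prop where
  nonneg : ∀ U, 0 ≤ m U
  univ : m Set.univ = 1
  add : ∀ U V, Disjoint U V → m (U ∪ V) = m U + m V
  shift : ∀ (t : ℤ) U, m (shiftSet t U) = m U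
  null : m Z = 0

namespace IsMean

variable {Z : Set ℤ} {m : Set ℤ → ℝ}

lemma empty (hm : IsMean Z m) : m ∅ = 0 := by
  have := hm.add ∅ ∅ (by simp)
  simp at this; exact this

lemma inter_diff (hm : IsMean Z m) (U V : Set ℤ) : m U = m (U ∩ V) + m (U \ V) := by
  rw [← hm.add _ _ (Set.disjoint_sdiff_right.mono_left Set.inter_subset_right), Set.inter_union_sdiff]

lemma mono (hm : IsMean Z m) {U V : Set ℤ} (h : U ⊆ V) : m U ≤ m V := by
  have := hm.inter_diff V U
  rw [Set.inter_eq_self_of_subset_right h] at this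
  linarith [hm.nonneg (V \ U)]

lemma le_one (hm : IsMean Z m) (U : Set ℤ) : m U ≤ 1 := by
  rw [← hm.univ]; exact hm.mono (Set.subset_univ _)

lemma union_inter (hm : IsMean Z m) (U V : Set ℤ) : m (U ∪ V) + m (U ∩ V) = m U + m V := by
  have h1 := hm.inter_diff V U
  have h2 := hm.add U (V \ U) Set.disjoint_sdiff_right
  rw [Set.union_sdiff_self] at h2
  rw [Set.inter_comm] at h1
  linarith

lemma union_le (hm : IsMean Z m) (U V : Set ℤ) : m (U ∪ V) ≤ m U + m V := by
  linarith [hm.union_inter U V, hm.nonneg (U ∩ V)]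

lemma biUnion_le (hm : IsMean Z m) {ι : Type*} (s : Finset ι) (f : ι → Set ℤ) :
    m (⋃ i ∈ s, f i) ≤ ∑ i ∈ s, m (f i) := by
  classical
  induction s using Finset.induction_on with
  | empty => simp [hm.empty]
  | insert a s ha ih =>
    rw [Finset.set_biUnion_insert, Finset.sum_insert ha]
    linarith [hm.union_le (f a) (⋃ i ∈ s, f i)]

lemma biUnion_eq (hm : IsMean Z m) {ι : Type*} (s : Finset ι) (f : ι → Set ℤ)
    (hf : ∀ i j, i ≠ j → Disjoint (f i) (f j)) :
    m (⋃ i ∈ s, f i) = ∑ i ∈ s, m (f i) := by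
  classical
  induction s using Finset.induction_on with
  | empty => simp [hm.empty]
  | insert a s ha ih =>
    rw [Finset.set_biUnion_insert, Finset.sum_insert ha, hm.add, ih]
    simp only [Set.disjoint_iUnion_right]
    intro i hi
    exact hf _ _ (fun h => ha (h ▸ hi))

lemma nonempty_of_pos (hm : IsMean Z m) {U : Set ℤ} (h : 0 < m U) : U.Nonempty := by
  rw [Set.nonempty_iff_ne_empty]
  rintro rfl
  rw [hm.empty] at h
  exact lt_irrefl _ h

end IsMean

/-- the set of means is compact -/
lemma isCompact_means (Z : Set ℤ) : IsCompact {m : Set ℤ → ℝ | IsMean Z m} := by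
  have hc : IsCompact (Set.pi Set.univ (fun _ : Set ℤ => Set.Icc (0:ℝ) 1)) :=
    isCompact_univ_pi (fun _ => isCompact_Icc)
  refine hc.of_isClosed_subset ?_ ?_
  · have : {m : Set ℤ → ℝ | IsMean Z m} =
        (⋂ U, {m | 0 ≤ m U}) ∩ {m | m Set.univ = 1} ∩
        (⋂ U, ⋂ V, ⋂ (_ : Disjoint U V), {m | m (U ∪ V) = m U + m V}) ∩
        (⋂ t : ℤ, ⋂ U, {m | m (shiftSet t U) = m U}) ∩ {m | m Z = 0} := by
      ext m
      simp only [Set.mem_ofPred_eq, Set.mem_inter_iff, Set.mem_iInter]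
      constructor
      · intro h; exact ⟨⟨⟨⟨h.nonneg, h.univ⟩, h.add⟩, h.shift⟩, h.null⟩
      · rintro ⟨⟨⟨⟨a, b⟩, c⟩, d⟩, e⟩; exact ⟨a, b, c, d, e⟩
    rw [this]
    refine IsClosed.inter (IsClosed.inter (IsClosed.inter (IsClosed.inter ?_ ?_) ?_) ?_) ?_
    · exact isClosed_iInter fun U => isClosed_le continuous_const (continuous_apply U)
    · exact isClosed_eq (continuous_apply _) continuous_const
    · exact isClosed_iInter fun U => isClosed_iInter fun V => isClosed_iInter fun _ =>
        isClosed_eq (continuous_apply _) ((continuous_apply U).add (continuous_apply V))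
    · exact isClosed_iInter fun U => isClosed_iInter fun V =>
        isClosed_eq (continuous_apply _) (continuous_apply _)
    · exact isClosed_eq (continuous_apply _) continuous_const
  · intro m hm U _
    exact ⟨hm.nonneg U, hm.le_one U⟩

/-- Ultralimit of functions with values in `[0,1]`. -/
lemma exists_ultralimit (F : ℕ → Set ℤ → ℝ) (h0 : ∀ n U, 0 ≤ F n U) (h1 : ∀ n U, F n U ≤ 1) :
    ∃ m : Set ℤ → ℝ, ∀ U, Tendsto (fun n => F n U) (hyperfilter ℕ : Filter ℕ) (𝓝 (m U)) := by
  have hc : IsCompact (Set.pi Set.univ (fun _ : Set ℤ => Set.Icc (0:ℝ) 1)) :=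
    isCompact_univ_pi (fun _ => isCompact_Icc)
  obtain ⟨m, -, hm⟩ := hc.ultrafilter_le_nhds ((hyperfilter ℕ).map F) (by
    rw [Filter.le_principal_iff]
    refine Filter.mem_map.2 (Filter.univ_mem' ?_)
    intro n U _
    exact ⟨h0 n U, h1 n U⟩)
  refine ⟨m, fun U => ?_⟩
  have : Tendsto F (hyperfilter ℕ : Filter ℕ) (𝓝 m) := hm
  exact (tendsto_pi_nhds.1 this) U

lemma hyper_le : (hyperfilter ℕ : Filter ℕ) ≤ atTop := by
  rw [← Nat.cofinite_eq_atTop]; exact hyperfilter_le_cofinite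

/-- A sequence which is within `1/n` has the same ultralimit. -/
lemma ultralimit_eq {u v : ℕ → ℝ} {a b : ℝ}
    (hu : Tendsto u (hyperfilter ℕ : Filter ℕ) (𝓝 a))
    (hv : Tendsto v (hyperfilter ℕ : Filter ℕ) (𝓝 b)) (c : ℝ)
    (h : ∀ n, |u n - v n| ≤ c / ((n:ℝ)+1)) : a = b := by
  have h0 : Tendsto (fun n : ℕ => c / ((n:ℝ)+1)) (hyperfilter ℕ : Filter ℕ) (𝓝 0) := by
    refine Tendsto.mono_left ?_ hyper_le
    have := (tendsto_one_div_add_atTop_nhds_zero_nat (𝕜 := ℝ)).const_mul c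
    simpa [div_eq_mul_inv] using this
  have h1 : Tendsto (fun n => u n - v n) (hyperfilter ℕ : Filter ℕ) (𝓝 0) :=
    squeeze_zero_norm h h0
  have := tendsto_nhds_unique h1 (hu.sub hv)
  linarith

/-- A shift invariance principle: invariance under `1` suffices. -/
lemma shift_of_one {m : Set ℤ → ℝ} (h : ∀ U, m (shiftSet 1 U) = m U) (t : ℤ) (U : Set ℤ) :
    m (shiftSet t U) = m U := by
  induction t using Int.induction_on with
  | zero => simp [shiftSet]
  | succ i ih =>
    rw [← ih, ← h (shiftSet (i:ℤ) U)]
    congr 1; ext x; simp only [shiftSet, Set.mem_ofPred_eq]; ring_nf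
  | pred i ih =>
    rw [← ih, ← h (shiftSet (-(i:ℤ)-1) U)]
    congr 1; ext x; simp only [shiftSet, Set.mem_ofPred_eq]; ring_nf

/-- Existence of a mean vanishing on a set with arbitrarily long gaps. -/
lemma exists_mean (Z : Set ℤ) (hZ : ∀ L : ℕ, ∃ y : ℤ, ∀ u ∈ Z, ¬ (y ≤ u ∧ u < y + L)) :
    ∃ m, IsMean Z m := by
  classical
  choose y hy using fun L : ℕ => hZ (L+1)
  let F : ℕ → Set ℤ → ℝ := fun n U =>
    (∑ e ∈ Finset.range (n+1), if y n + e ∈ U then (1:ℝ) else 0) / ((n:ℝ)+1)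
  have hF0 : ∀ n U, 0 ≤ F n U := fun n U => by
    apply div_nonneg
    · exact Finset.sum_nonneg fun i _ => by split_ifs <;> norm_num
    · positivity
  have hF1 : ∀ n U, F n U ≤ 1 := fun n U => by
    rw [div_le_one (by positivity)]
    calc _ ≤ ∑ e ∈ Finset.range (n+1), (1:ℝ) :=
          Finset.sum_le_sum fun i _ => by split_ifs <;> norm_num
      _ = _ := by simp
  obtain ⟨m, hm⟩ := exists_ultralimit F hF0 hF1
  refine ⟨m, ?_, ?_, ?_, ?_, ?_⟩
  · intro U; exact ge_of_tendsto' (hm U) (fun n => hF0 n U)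
  · refine tendsto_nhds_unique (hm _) ?_
    have : ∀ n, F n Set.univ = 1 := fun n => by
      simp only [F]
      rw [div_eq_one_iff_eq (by positivity)]
      simp
    simp only [this]
    exact tendsto_const_nhds
  · intro U V hUV
    refine tendsto_nhds_unique (hm _) ?_
    have : ∀ n, F n (U ∪ V) = F n U + F n V := fun n => by
      simp only [F]
      rw [← add_div, ← Finset.sum_add_distrib]
      congr 1
      refine Finset.sum_congr rfl fun e _ => ?_
      have : y n + (e:ℤ) ∈ U → y n + (e:ℤ) ∉ V := fun h => Set.disjoint_left.1 hUV h
      by_cases h1 : y n + (e:ℤ) ∈ U <;> by_cases h2 : y n + (e:ℤ) ∈ V <;> simp_all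
    simp only [this]
    exact (hm U).add (hm V)
  · refine shift_of_one fun U => ?_
    refine ultralimit_eq (hm _) (hm _) 2 fun n => ?_
    have : F n (shiftSet 1 U) - F n U = ((if y n + (n+1:ℕ) ∈ U then (1:ℝ) else 0) -
        (if y n ∈ U then (1:ℝ) else 0)) / ((n:ℝ)+1) := by
      simp only [F]
      rw [← sub_div]
      congr 1
      have h1 := Finset.sum_range_succ (fun e : ℕ => if y n + e ∈ U then (1:ℝ) else 0) (n+1)
      have h2 := Finset.sum_range_succ' (fun e : ℕ => if y n + e ∈ U then (1:ℝ) else 0) (n+1)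
      have h3 : ∑ e ∈ Finset.range (n+1), (if y n + e ∈ shiftSet 1 U then (1:ℝ) else 0) =
          ∑ e ∈ Finset.range (n+1), (if y n + (e+1:ℕ) ∈ U then (1:ℝ) else 0) := by
        refine Finset.sum_congr rfl fun e _ => ?_
        have : y n + (e:ℤ) ∈ shiftSet 1 U ↔ y n + ((e+1:ℕ):ℤ) ∈ U := by
          simp only [shiftSet, Set.mem_ofPred_eq]
          push_cast
          rw [add_assoc]
        simp only [this]
      rw [h3]
      simp only [Nat.cast_zero, add_zero] at h2
      linarith
    rw [this, abs_div, abs_of_nonneg (by positivity : (0:ℝ) ≤ (n:ℝ)+1)]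
    gcongr
    split_ifs <;> norm_num
  · refine tendsto_nhds_unique (hm _) ?_
    have : ∀ n, F n Z = 0 := fun n => by
      simp only [F]
      rw [div_eq_zero_iff]; left
      refine Finset.sum_eq_zero fun e he => ?_
      rw [if_neg]
      intro h
      refine hy n _ h ⟨by omega, ?_⟩
      have := Finset.mem_range.1 he
      push_cast; omega
    simp only [this]
    exact tendsto_const_nhds

/-- Extreme invariant means. -/
lemma exists_extreme (Z : Set ℤ) (hZ : ∃ m, IsMean Z m) :
    ∃ m, m ∈ Set.extremePoints ℝ {m : Set ℤ → ℝ | IsMean Z m} :=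
  (isCompact_means Z).extremePoints_nonempty hZ

/-- Ergodicity of extreme means. -/
lemma ergodic_bound {Z : Set ℤ} {m : Set ℤ → ℝ}
    (hm : m ∈ Set.extremePoints ℝ {m : Set ℤ → ℝ | IsMean Z m}) (U V : Set ℤ) (κ : ℝ)
    (h : ∀ e, m (U ∩ shiftSet e V) ≤ κ) : m U * m V ≤ κ := by
  obtain ⟨hM, hext⟩ := hm
  have hM : IsMean Z m := hM
  have hκ : 0 ≤ κ := (hM.nonneg _).trans (h 0)
  rcases (hM.nonneg V).eq_or_lt with hc | hc
  · rw [← hc]; simpa using hκ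
  rcases (hM.le_one V).eq_or_lt with hc1 | hc1
  · have h1 := hM.inter_diff Set.univ V
    have h2 := hM.inter_diff U V
    have h3 := hM.mono (show U \ V ⊆ Set.univ \ V from Set.sdiff_subset_sdiff_left (Set.subset_univ _))
    have h4 := h 0
    have h5 : shiftSet 0 V = V := by ext; simp [shiftSet]
    rw [Set.univ_inter, hM.univ] at h1
    rw [h5] at h4
    rw [hc1]
    linarith
  let F : ℕ → Set ℤ → ℝ := fun n W =>
    (∑ e ∈ Finset.range (n+1), m (W ∩ shiftSet e V)) / ((n:ℝ)+1)
  have hF0 : ∀ n U, 0 ≤ F n U := fun n U =>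
    div_nonneg (Finset.sum_nonneg fun i _ => hM.nonneg _) (by positivity)
  have hFle : ∀ n W c, (∀ e, m (W ∩ shiftSet e V) ≤ c) → F n W ≤ c := fun n W c hc => by
    rw [div_le_iff₀ (by positivity)]
    calc _ ≤ ∑ e ∈ Finset.range (n+1), c :=
          Finset.sum_le_sum fun i _ => hc _
      _ = _ := by simp; ring
  obtain ⟨p, hp⟩ := exists_ultralimit F hF0 (fun n W => hFle n W 1 (fun e => hM.le_one _))
  have p0 : ∀ W, 0 ≤ p W := fun W => ge_of_tendsto' (hp W) (fun n => hF0 n W)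
  have ple : ∀ W, p W ≤ m W := fun W => le_of_tendsto' (hp W) (fun n => hFle n W _
    (fun e => hM.mono Set.inter_subset_left))
  have puniv : p Set.univ = m V := by
    refine tendsto_nhds_unique (hp _) ?_
    have : ∀ n, F n Set.univ = m V := fun n => by
      simp only [F, Set.univ_inter, hM.shift]
      rw [Finset.sum_const, Finset.card_range, nsmul_eq_mul]
      field_simp
      push_cast; ring
    simp only [this]
    exact tendsto_const_nhds
  have padd : ∀ W W', Disjoint W W' → p (W ∪ W') = p W + p W' := by
    intro W W' hd
    refine tendsto_nhds_unique (hp _) ?_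
    have : ∀ n, F n (W ∪ W') = F n W + F n W' := fun n => by
      simp only [F]
      rw [← add_div, ← Finset.sum_add_distrib]
      congr 1
      refine Finset.sum_congr rfl fun e _ => ?_
      rw [Set.union_inter_distrib_right, hM.add]
      exact hd.mono Set.inter_subset_left Set.inter_subset_left
    simp only [this]
    exact (hp W).add (hp W')
  have pshift : ∀ (t : ℤ) W, p (shiftSet t W) = p W := by
    refine shift_of_one fun W => ?_
    refine ultralimit_eq (hp _) (hp _) 2 fun n => ?_
    have key : ∀ e : ℕ, m (shiftSet 1 W ∩ shiftSet ((e+1:ℕ):ℤ) V) = m (W ∩ shiftSet (e:ℤ) V) := by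
      intro e
      rw [← hM.shift 1 (W ∩ shiftSet (e:ℤ) V)]
      congr 1
      ext x
      simp only [shiftSet, Set.mem_inter_iff, Set.mem_ofPred_eq]
      push_cast
      rw [show x + ((e:ℤ)+1) = x + 1 + e by ring]
    have : F n (shiftSet 1 W) - F n W = (m (shiftSet 1 W ∩ shiftSet ((0:ℕ):ℤ) V) -
        m (W ∩ shiftSet (n:ℤ) V)) / ((n:ℝ)+1) := by
      simp only [F]
      rw [← sub_div]
      congr 1
      rw [Finset.sum_range_succ', Finset.sum_range_succ]
      simp only [key]
      ring
    rw [this, abs_div, abs_of_nonneg (by positivity : (0:ℝ) ≤ (n:ℝ)+1)]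
    gcongr
    rw [abs_le]
    constructor <;> linarith [hM.nonneg (shiftSet 1 W ∩ shiftSet ((0:ℕ):ℤ) V),
      hM.le_one (shiftSet 1 W ∩ shiftSet ((0:ℕ):ℤ) V), hM.nonneg (W ∩ shiftSet (n:ℤ) V),
      hM.le_one (W ∩ shiftSet (n:ℤ) V)]
  have hc' : 0 < 1 - m V := by linarith
  have hp1 : IsMean Z (fun W => p W / m V) := by
    refine ⟨fun W => div_nonneg (p0 W) hc.le, ?_, ?_, ?_, ?_⟩
    · rw [puniv]; field_simp
    · intro W W' hd; rw [padd _ _ hd, add_div]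
    · intro t W; rw [pshift]
    · have : p Z = 0 := le_antisymm ((ple Z).trans hM.null.le) (p0 Z)
      rw [this, zero_div]
  have hp2 : IsMean Z (fun W => (m W - p W) / (1 - m V)) := by
    refine ⟨fun W => div_nonneg (sub_nonneg.2 (ple W)) hc'.le, ?_, ?_, ?_, ?_⟩
    · rw [puniv, hM.univ]; field_simp
    · intro W W' hd; rw [padd _ _ hd, hM.add _ _ hd, ← add_div]; congr 1; ring
    · intro t W; rw [pshift, hM.shift]
    · have : p Z = 0 := le_antisymm ((ple Z).trans hM.null.le) (p0 Z)
      rw [this, hM.null, sub_zero, zero_div]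
  have hseg : m ∈ openSegment ℝ (fun W => p W / m V) (fun W => (m W - p W) / (1 - m V)) := by
    refine ⟨m V, 1 - m V, hc, hc', by ring, ?_⟩
    funext W
    simp only [Pi.add_apply, Pi.smul_apply, smul_eq_mul]
    field_simp
    ring
  have heq := congrFun (hext hp1 hp2 hseg) U
  have hpU : p U ≤ κ := le_of_tendsto' (hp U) (fun n => hFle n U _ h)
  have : p U = m U * m V := by
    rw [← heq]; field_simp
  linarith

/-- Periodic sets of integers. -/
def PerSet (q : ℕ) (C : Set ℤ) : Prop := ∀ x : ℤ, x + q ∈ C ↔ x ∈ C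

lemma PerSet.mul {q : ℕ} {C : Set ℤ} (h : PerSet q C) (x k : ℤ) : x + k * q ∈ C ↔ x ∈ C := by
  induction k using Int.induction_on with
  | zero => simp
  | succ i ih => rw [← ih, ← h (x + i * q)]; ring_nf
  | pred i ih => rw [← ih, ← h (x + (-(i:ℤ) - 1) * q)]; ring_nf

lemma PerSet.of_dvd {q : ℕ} {C : Set ℤ} (h : PerSet q C) {x y : ℤ} (hd : (q:ℤ) ∣ x - y) :
    x ∈ C ↔ y ∈ C := by
  obtain ⟨k, hk⟩ := hd
  rw [show x = y + k * q by linarith]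
  exact h.mul y k

lemma finite_perSet (q : ℕ) (hq : 0 < q) : {C : Set ℤ | PerSet q C}.Finite := by
  refine Set.Finite.of_finite_image (f := fun C => C ∩ Set.Ico (0:ℤ) q) ?_ ?_
  · refine ((Set.finite_Ico (0:ℤ) q).finite_subsets).subset ?_
    rintro _ ⟨C, -, rfl⟩
    exact Set.inter_subset_right
  · intro C hC C' hC' h
    have hC : PerSet q C := hC
    have hC' : PerSet q C' := hC'
    have hq' : (0:ℤ) < q := by exact_mod_cast hq
    ext x
    have hd : (q:ℤ) ∣ x - x % q := Int.dvd_self_sub_emod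
    rw [hC.of_dvd hd, hC'.of_dvd hd]
    have hx : x % q ∈ Set.Ico (0:ℤ) q := ⟨Int.emod_nonneg _ hq'.ne', Int.emod_lt_of_pos _ hq'⟩
    have := Set.ext_iff.1 h (x % q)
    simp only [Set.mem_inter_iff, hx, and_true] at this
    exact this

section WK
variable {Z : Set ℤ} {m : Set ℤ → ℝ}

/-- The measure of a residue class. -/
lemma IsMean.class_le (hm : IsMean Z m) (q : ℕ) (hq : 0 < q) (i : ℤ) :
    m {x | (q:ℤ) ∣ x - i} = 1 / q := by
  have hq' : (0:ℤ) < q := by exact_mod_cast hq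
  have h1 : m (⋃ r ∈ Finset.range q, {x | (q:ℤ) ∣ x - r}) =
      ∑ r ∈ Finset.range q, m {x : ℤ | (q:ℤ) ∣ x - r ∧ r < q} := by
    rw [← hm.biUnion_eq]
    · congr 1; ext x; simp only [Set.mem_iUnion, Finset.mem_range, Set.mem_ofPred_eq, exists_prop]
      constructor
      · rintro ⟨r, h1, h2⟩; exact ⟨r, h1, h2, h1⟩
      · rintro ⟨r, h1, h2, h3⟩; exact ⟨r, h1, h2⟩
    · intro r s hrs
      rw [Set.disjoint_left]
      rintro x ⟨h1, h2⟩ ⟨h3, h4⟩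
      apply hrs
      have : (q:ℤ) ∣ (r:ℤ) - s := by have := dvd_sub h3 h1; ring_nf at this ⊢; exact this
      obtain ⟨k, hk⟩ := this
      have hk0 : k = 0 := by
        have h5 : (q:ℤ) * k < q * 1 := by omega
        have h6 : (q:ℤ) * (-1) < q * k := by omega
        have h5 := lt_of_mul_lt_mul_left h5 hq'.le
        have h6 := lt_of_mul_lt_mul_left h6 hq'.le
        omega
      subst hk0; omega
  have h2 : (⋃ r ∈ Finset.range q, {x | (q:ℤ) ∣ x - r}) = Set.univ := by
    ext x
    simp only [Set.mem_iUnion, Finset.mem_range, Set.mem_ofPred_eq, exists_prop, Set.mem_univ, iff_true]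
    refine ⟨(x % q).toNat, ?_, ?_⟩
    · have := Int.emod_lt_of_pos x hq'
      have := Int.emod_nonneg x hq'.ne'
      omega
    · rw [Int.toNat_of_nonneg (Int.emod_nonneg x hq'.ne')]
      exact Int.dvd_self_sub_emod
  have h3 : ∀ r ∈ Finset.range q, m {x : ℤ | (q:ℤ) ∣ x - r ∧ r < q} = m {x | (q:ℤ) ∣ x - i} := by
    intro r hr
    rw [← hm.shift (i - r) {x | (q:ℤ) ∣ x - i}]
    congr 1; ext x
    simp only [shiftSet, Set.mem_ofPred_eq, Finset.mem_range.1 hr, and_true]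
    rw [show x + (i - r) - i = x - r by ring]
  rw [h2, hm.univ, Finset.sum_congr rfl h3] at h1
  simp only [Finset.sum_const, Finset.card_range, nsmul_eq_mul] at h1
  rw [eq_div_iff (by exact_mod_cast hq.ne')]
  linarith

lemma IsMean.perSet_pos (hm : IsMean Z m) (q : ℕ) (hq : 0 < q) {C : Set ℤ} (hC : PerSet q C)
    (hne : C.Nonempty) : 0 < m C := by
  obtain ⟨i, hi⟩ := hne
  have h1 : 0 < m {x | (q:ℤ) ∣ x - i} := by
    rw [hm.class_le q hq i]; positivity
  refine h1.trans_le (hm.mono ?_)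
  intro x hx
  exact (hC.of_dvd hx).2 hi

/-- Return times of a set of positive measure. -/
lemma IsMean.exists_return (hm : IsMean Z m) {B : Set ℤ} {ε : ℝ} (n : ℕ) (hB : 2 ≤ n * m B)
    (hε : (n:ℝ)^2 * ε < 1) : ∃ t : ℕ, 0 < t ∧ t ≤ n ∧ ε < m (B ∩ shiftSet t B) := by
  by_contra! hcon
  have key : ∀ k : ℕ, k ≤ n → k * m B - k * n * ε ≤ m (⋃ i ∈ Finset.range k, shiftSet i B) := by
    intro k
    induction k with
    | zero => intro _; simp [hm.empty]
    | succ k ih =>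
      intro hk
      have ih := ih (by omega)
      rw [Finset.range_add_one, Finset.set_biUnion_insert]
      have h1 := hm.union_inter (shiftSet k B) (⋃ i ∈ Finset.range k, shiftSet i B)
      rw [hm.shift] at h1
      have h2 : m (shiftSet k B ∩ ⋃ i ∈ Finset.range k, shiftSet i B) ≤ k * ε := by
        rw [Set.inter_iUnion₂]
        refine (hm.biUnion_le _ _).trans ?_
        calc _ ≤ ∑ i ∈ Finset.range k, ε := by
              refine Finset.sum_le_sum fun i hi => ?_
              have hi := Finset.mem_range.1 hi
              have := hcon (k - i) (by omega) (by omega)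
              rw [← hm.shift i] at this
              refine le_trans (le_of_eq ?_) this
              congr 1; ext x
              simp only [shiftSet, Set.mem_inter_iff, Set.mem_ofPred_eq]
              rw [Nat.cast_sub hi.le, show x + (i:ℤ) + ((k:ℤ) - i) = x + k by ring]
              exact and_comm
          _ = _ := by simp
      have h3 : (k:ℝ) * ε ≤ n * ε := by
        have h0 : 0 ≤ ε := (hm.nonneg _).trans (hcon 1 (by omega) (by omega))
        have : (k:ℝ) ≤ n := by exact_mod_cast (by omega : k ≤ n)
        gcongr
      push_cast
      nlinarith
  have := key n le_rfl
  have h1 := hm.le_one (⋃ i ∈ Finset.range n, shiftSet i B)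
  nlinarith

/-- Approximate weak Kneser theorem. -/
lemma weak_kneser_aux (hm : m ∈ Set.extremePoints ℝ {m : Set ℤ → ℝ | IsMean Z m})
    (D : Set ℤ) (s β ε : ℝ) (hβ : 0 < β) (A B : Set ℤ) (hAB : ∀ a ∈ A, ∀ b ∈ B, a + b ∈ D)
    (hs : s ≤ m A + m B) (hA : 0 < m A) (hB : m B ≤ β + ε)
    (hmin : ∀ A' B' : Set ℤ, (∀ a ∈ A', ∀ b ∈ B', a + b ∈ D) → s ≤ m A' + m B' →
      0 < m A' → 0 < m B' → β ≤ m B') (hB0 : 0 < m B)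
    (n : ℕ) (hn : 2 ≤ n * β) (hε : (n:ℝ)^2 * ε < 1) (hε0 : 0 ≤ ε) :
    ∃ q : ℕ, 0 < q ∧ q ≤ n ∧ ∃ C : Set ℤ, C.Nonempty ∧ PerSet q C ∧ m (C \ D) ≤ ε * n / β ∧
      s - 1 / q - ε * n / β ≤ m C := by
  have hM : IsMean Z m := hm.1
  have hBβ : β ≤ m B := hmin A B hAB hs hA hB0
  set E : Set ℤ := {e | 0 < m (B ∩ shiftSet e A)} with hE
  -- dichotomy
  have hdich : ∀ e ∈ E, m (B \ shiftSet e A) ≤ ε := by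
    intro e he
    have h1 := hmin (A ∪ shiftSet (-e) B) (B ∩ shiftSet e A) ?_ ?_ ?_ he
    · have := hM.inter_diff B (shiftSet e A)
      linarith
    · rintro a (ha | ha) b ⟨hb, hb'⟩
      · exact hAB a ha b hb
      · have := hAB (b + e) hb' (a + -e) ha
        rwa [show b + e + (a + -e) = a + b by ring] at this
    · have h2 := hM.union_inter A (shiftSet (-e) B)
      rw [hM.shift] at h2
      have h3 : m (A ∩ shiftSet (-e) B) = m (B ∩ shiftSet e A) := by
        rw [← hM.shift e (A ∩ shiftSet (-e) B)]
        congr 1; ext x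
        simp only [shiftSet, Set.mem_inter_iff, Set.mem_ofPred_eq, add_neg_cancel_right]
        exact and_comm
      linarith
    · exact hA.trans_le (hM.mono Set.subset_union_left)
  have hEP : ∀ t, ε < m (B ∩ shiftSet t B) → ∀ e ∈ E, e + t ∈ E := by
    intro t ht e he
    have h1 : m (shiftSet t (B \ shiftSet e A)) ≤ ε := by rw [hM.shift]; exact hdich e he
    have h2 : B ∩ shiftSet t B ⊆ (B ∩ shiftSet (e + t) A) ∪ shiftSet t (B \ shiftSet e A) := by
      rintro x ⟨hx, hx'⟩
      by_cases h : x + (e + t) ∈ A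
      · exact Or.inl ⟨hx, h⟩
      · refine Or.inr ⟨hx', ?_⟩
        intro h'
        apply h
        have : x + t + e ∈ A := h'
        rwa [show x + (e + t) = x + t + e by ring]
    have h3 := (hM.mono h2).trans (hM.union_le _ _)
    show 0 < m _
    linarith
  have hsymm : ∀ t, m (B ∩ shiftSet (-t) B) = m (B ∩ shiftSet t B) := by
    intro t
    rw [← hM.shift t (B ∩ shiftSet (-t) B)]
    congr 1; ext x
    simp only [shiftSet, Set.mem_inter_iff, Set.mem_ofPred_eq, add_neg_cancel_right]
    exact and_comm
  -- stabilizer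
  let H : AddSubgroup ℤ :=
    { carrier := {t | ∀ e, e + t ∈ E ↔ e ∈ E}
      zero_mem' := by intro e; simp
      add_mem' := by
        intro a b ha hb e
        rw [← add_assoc, hb, ha]
      neg_mem' := by
        intro a ha e
        have := ha (e + -a)
        rw [← this]; simp }
  have hPH : ∀ t, ε < m (B ∩ shiftSet t B) → t ∈ H := by
    intro t ht e
    refine ⟨fun h => ?_, fun h => hEP t ht e h⟩
    have := hEP (-t) (by rw [hsymm]; exact ht) _ h
    simpa using this
  obtain ⟨t, ht0, htn, htε⟩ := hM.exists_return (B := B) n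
    (hn.trans (by gcongr)) hε
  have htH : (t:ℤ) ∈ H := hPH _ htε
  obtain ⟨q0, hq0⟩ := Int.subgroup_cyclic H
  have hmemH : ∀ x, x ∈ H ↔ q0 ∣ x := by
    intro x; rw [hq0, ← AddSubgroup.zmultiples_eq_closure, Int.mem_zmultiples_iff]
  set q := q0.natAbs with hq
  have hmemH : ∀ x, x ∈ H ↔ (q:ℤ) ∣ x := by
    intro x; rw [hmemH, hq, Int.natAbs_dvd]
  have hqt : q ∣ t := by exact_mod_cast (hmemH t).1 htH
  have hqpos : 0 < q := Nat.pos_of_dvd_of_pos hqt ht0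
  have hqn : q ≤ n := (Nat.le_of_dvd ht0 hqt).trans htn
  have hq' : (0:ℤ) < q := by exact_mod_cast hqpos
  have hqR : (0:ℝ) < q := by exact_mod_cast hqpos
  have hEper : ∀ x y : ℤ, (q:ℤ) ∣ x - y → (x ∈ E ↔ y ∈ E) := by
    intro x y h
    have := (hmemH _).2 h y
    rwa [show y + (x - y) = x by ring] at this
  -- a large class
  obtain ⟨i, hi⟩ : ∃ i : ℤ, β / q ≤ m (B ∩ {x | (q:ℤ) ∣ x - i}) := by
    by_contra! hcon
    have h1 : B ⊆ ⋃ r ∈ Finset.range q, (B ∩ {x | (q:ℤ) ∣ x - r}) := by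
      intro x hx
      simp only [Set.mem_iUnion, Finset.mem_range, exists_prop]
      refine ⟨(x % q).toNat, ?_, hx, ?_⟩
      · have := Int.emod_lt_of_pos x hq'
        have := Int.emod_nonneg x hq'.ne'
        omega
      · show (q:ℤ) ∣ x - ((x % q).toNat : ℤ)
        rw [Int.toNat_of_nonneg (Int.emod_nonneg x hq'.ne')]
        exact Int.dvd_self_sub_emod
    have h2 := (hM.mono h1).trans (hM.biUnion_le _ _)
    have h3 : ∑ r ∈ Finset.range q, m (B ∩ {x | (q:ℤ) ∣ x - r}) <
        ∑ r ∈ Finset.range q, β / q :=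
      Finset.sum_lt_sum_of_nonempty ⟨0, Finset.mem_range.2 hqpos⟩ (fun r _ => hcon r)
    rw [Finset.sum_const, Finset.card_range, nsmul_eq_mul, mul_div_cancel₀ _ hqR.ne'] at h3
    linarith
  set Bi := B ∩ {x | (q:ℤ) ∣ x - i} with hBi
  have hBipos : 0 < m Bi := lt_of_lt_of_le (by positivity) hi
  have herg : ∀ V, (∀ e, m (Bi ∩ shiftSet e V) ≤ ε) → m V ≤ ε * n / β := by
    intro V hV
    have h1 := ergodic_bound hm Bi V ε hV
    have h2 : β / q * m V ≤ ε := (mul_le_mul_of_nonneg_right hi (hM.nonneg V)).trans h1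
    rw [le_div_iff₀ hβ]
    have h3 : β * m V ≤ ε * q := by
      rw [div_mul_eq_mul_div, div_le_iff₀ hqR] at h2; exact h2
    have h4 : ε * q ≤ ε * n := by gcongr
    linarith
  have hV1 : m (B \ Bi) ≤ ε * n / β := by
    apply herg
    intro e
    by_cases he : e ∈ H
    · have : Bi ∩ shiftSet e (B \ Bi) = ∅ := by
        rw [Set.eq_empty_iff_forall_notMem]
        rintro x ⟨⟨hx, hx'⟩, ⟨hy, hy'⟩⟩
        apply hy'
        refine ⟨hy, ?_⟩
        have h1 : (q:ℤ) ∣ x - i := hx'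
        have := dvd_add h1 ((hmemH e).1 he)
        show (q:ℤ) ∣ x + e - i
        rwa [show x + e - i = x - i + e by ring]
      rw [this, hM.empty]; exact hε0
    · have : m (B ∩ shiftSet e B) ≤ ε := by
        by_contra hh
        exact he (hPH e (not_le.1 hh))
      refine (hM.mono ?_).trans this
      rintro x ⟨hx, hy⟩
      exact ⟨hx.1, hy.1⟩
  have hclass : ∀ (e x : ℤ), x ∈ Bi → (x + e - i ∈ E ↔ e ∈ E) := by
    intro e x hx
    apply hEper
    have h1 : (q:ℤ) ∣ x - i := hx.2
    rwa [show x + e - i - e = x - i by ring]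
  have hV2 : m (A \ shiftSet (-i) E) = 0 := by
    have h1 := ergodic_bound hm Bi (A \ shiftSet (-i) E) 0 ?_
    · have := hM.nonneg (A \ shiftSet (-i) E)
      nlinarith
    · intro e
      by_cases he : e ∈ E
      · have : Bi ∩ shiftSet e (A \ shiftSet (-i) E) = ∅ := by
          rw [Set.eq_empty_iff_forall_notMem]
          rintro x ⟨hx, ⟨hy, hy'⟩⟩
          exact hy' ((hclass e x hx).2 he)
        rw [this, hM.empty]
      · refine le_trans (hM.mono ?_) (not_lt.1 he)
        rintro x ⟨hx, hy⟩
        exact ⟨hx.1, hy.1⟩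
  have hV3 : m (shiftSet (-i) E \ A) ≤ ε * n / β := by
    apply herg
    intro e
    by_cases he : e ∈ E
    · refine le_trans (hM.mono ?_) (hdich e he)
      rintro x ⟨hx, hy⟩
      exact ⟨hx.1, hy.2⟩
    · have : Bi ∩ shiftSet e (shiftSet (-i) E \ A) = ∅ := by
        rw [Set.eq_empty_iff_forall_notMem]
        rintro x ⟨hx, ⟨hy, hy'⟩⟩
        exact he ((hclass e x hx).1 hy)
      rw [this, hM.empty]; exact hε0
  obtain ⟨b0, hb0⟩ := hM.nonempty_of_pos hB0
  have hAC : m A ≤ m (shiftSet (-i) E) := by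
    have h1 := hM.inter_diff A (shiftSet (-i) E)
    have h2 := hM.mono (Set.inter_subset_right : A ∩ shiftSet (-i) E ⊆ _)
    linarith
  have hC : m (shiftSet (-b0) (shiftSet (-i) E)) = m (shiftSet (-i) E) := hM.shift _ _
  refine ⟨q, hqpos, hqn, shiftSet (-b0) (shiftSet (-i) E), ?_, ?_, ?_, ?_⟩
  · apply hM.nonempty_of_pos; linarith
  · intro x
    apply hEper
    rw [show x + q + -b0 + -i - (x + -b0 + -i) = q by ring]
  · rw [← hM.shift (-b0)] at hV3
    refine le_trans (hM.mono ?_) hV3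
    rintro x ⟨hx, hx'⟩
    refine ⟨hx, fun h => hx' ?_⟩
    have := hAB _ h b0 hb0
    simpa using this
  · have h1 := hM.inter_diff B Bi
    have h2 : m (B ∩ Bi) ≤ 1 / q := by
      rw [← hM.class_le q hqpos i]
      exact hM.mono (fun x hx => hx.2.2)
    rw [hC]
    linarith

end WK

/-- Uniformization over a finite set of candidates. -/
lemma finite_uniform {α : Type*} {F : Set α} (hF : F.Finite) (P : α → ℝ → Prop)
    (hmono : ∀ a δ δ', δ ≤ δ' → P a δ → P a δ')
    (h : ∀ δ > 0, ∃ a ∈ F, P a δ) : ∃ a ∈ F, ∀ δ > 0, P a δ := by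
  by_contra! hcon
  have : ∃ δ₀ > (0:ℝ), ∀ a ∈ F, ¬ P a δ₀ := by
    clear h
    induction F, hF using Set.Finite.induction_on with
    | empty => exact ⟨1, one_pos, by simp⟩
    | @insert a s ha hs ih =>
      obtain ⟨δ1, h1, h1'⟩ := ih (fun b hb => hcon b (Set.mem_insert_of_mem _ hb))
      obtain ⟨δ2, h2, h2'⟩ := hcon a (Set.mem_insert _ _)
      refine ⟨min δ1 δ2, lt_min h1 h2, ?_⟩
      rintro b (rfl | hb) hP
      · exact h2' (hmono _ _ _ (min_le_right _ _) hP)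
      · exact h1' b hb (hmono _ _ _ (min_le_left _ _) hP)
  obtain ⟨δ₀, h0, h1⟩ := this
  obtain ⟨a, ha, hP⟩ := h δ₀ h0
  exact h1 a ha hP

section WK2
variable {Z : Set ℤ} {m : Set ℤ → ℝ}

/-- The weak Kneser theorem for extreme invariant means. -/
lemma weak_kneser (hm : m ∈ Set.extremePoints ℝ {m : Set ℤ → ℝ | IsMean Z m})
    (D A B : Set ℤ) (hAB : ∀ a ∈ A, ∀ b ∈ B, a + b ∈ D) (hA : 0 < m A) (hB : 0 < m B) :
    m A + m B ≤ m D ∨ ∃ q : ℕ, 0 < q ∧ ∃ C : Set ℤ, C.Nonempty ∧ PerSet q C ∧ m (C \ D) = 0 ∧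
      m A + m B - 1 / q ≤ m C := by
  have hM : IsMean Z m := hm.1
  set s := m A + m B with hs
  let T : Set ℝ := {x | ∃ A' B' : Set ℤ, (∀ a ∈ A', ∀ b ∈ B', a + b ∈ D) ∧ s ≤ m A' + m B' ∧
      0 < m A' ∧ 0 < m B' ∧ x = m B'}
  have hTne : T.Nonempty := ⟨m B, A, B, hAB, le_rfl, hA, hB, rfl⟩
  have hTbd : BddBelow T := ⟨0, by rintro x ⟨A', B', -, -, -, h, rfl⟩; exact h.le⟩
  set β := sInf T with hβ
  have hβ0 : 0 ≤ β := le_csInf hTne (by rintro x ⟨A', B', -, -, -, h, rfl⟩; exact h.le)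
  have hmin : ∀ A' B' : Set ℤ, (∀ a ∈ A', ∀ b ∈ B', a + b ∈ D) → s ≤ m A' + m B' →
      0 < m A' → 0 < m B' → β ≤ m B' := fun A' B' h1 h2 h3 h4 =>
    csInf_le hTbd ⟨A', B', h1, h2, h3, h4, rfl⟩
  have happ : ∀ ε > 0, ∃ A' B' : Set ℤ, (∀ a ∈ A', ∀ b ∈ B', a + b ∈ D) ∧ s ≤ m A' + m B' ∧
      0 < m A' ∧ 0 < m B' ∧ m B' ≤ β + ε := by
    intro ε hε
    obtain ⟨x, ⟨A', B', h1, h2, h3, h4, rfl⟩, hx⟩ :=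
      exists_lt_of_csInf_lt hTne (show sInf T < β + ε by linarith)
    exact ⟨A', B', h1, h2, h3, h4, hx.le⟩
  rcases hβ0.eq_or_lt with hβz | hβpos
  · left
    refine le_of_forall_pos_le_add fun ε hε => ?_
    obtain ⟨A', B', h1, h2, h3, h4, h5⟩ := happ ε hε
    obtain ⟨b, hb⟩ := hM.nonempty_of_pos h4
    have : m A' ≤ m D := by
      rw [← hM.shift (-b) A']
      apply hM.mono
      intro x hx
      have := h1 _ hx b hb
      simpa using this
    linarith
  · right
    obtain ⟨n, hn⟩ := exists_nat_ge (2 / β)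
    have hn : 2 ≤ n * β := by rwa [div_le_iff₀ hβpos] at hn
    have hn0 : (0:ℝ) < n := by
      by_contra h
      have : (n:ℝ) * β ≤ 0 := mul_nonpos_of_nonpos_of_nonneg (not_lt.1 h) hβpos.le
      linarith
    have hfin : {p : ℕ × Set ℤ | 0 < p.1 ∧ p.1 ≤ n ∧ PerSet p.1 p.2}.Finite := by
      have : {p : ℕ × Set ℤ | 0 < p.1 ∧ p.1 ≤ n ∧ PerSet p.1 p.2} ⊆
          ⋃ q ∈ Finset.Icc 1 n, ({q} : Set ℕ) ×ˢ {C : Set ℤ | PerSet q C} := by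
        rintro ⟨q, C⟩ ⟨h1, h2, h3⟩
        simp only [Set.mem_iUnion]
        exact ⟨q, Finset.mem_Icc.2 ⟨h1, h2⟩, rfl, h3⟩
      refine Set.Finite.subset ?_ this
      refine Set.Finite.biUnion (Finset.finite_toSet _) ?_
      intro q hq
      exact (Set.finite_singleton q).prod (finite_perSet q (Finset.mem_Icc.1 hq).1)
    obtain ⟨⟨q, C⟩, ⟨hq0, hqn, hC⟩, hP⟩ := finite_uniform hfin
      (fun p δ => p.2.Nonempty ∧ m (p.2 \ D) ≤ δ ∧ s - 1 / p.1 - δ ≤ m p.2)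
      (by rintro ⟨q, C⟩ δ δ' hd ⟨h1, h2, h3⟩; exact ⟨h1, h2.trans hd, by linarith⟩)
      (by
        intro δ hδ
        set ε := min (δ * β / n) (1 / (2 * (n:ℝ)^2)) with hε
        have hε0 : 0 < ε := by positivity
        obtain ⟨A', B', h1, h2, h3, h4, h5⟩ := happ ε hε0
        have he1 : (n:ℝ)^2 * ε < 1 := by
          calc (n:ℝ)^2 * ε ≤ (n:ℝ)^2 * (1 / (2 * (n:ℝ)^2)) := by gcongr; exact min_le_right _ _
            _ = 1/2 := by field_simp
            _ < 1 := by norm_num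
        have he2 : ε * n / β ≤ δ := by
          calc ε * n / β ≤ (δ * β / n) * n / β := by gcongr; exact min_le_left _ _
            _ = δ := by field_simp
        obtain ⟨q, hq0, hqn, C, hCne, hC, hc1, hc2⟩ := weak_kneser_aux hm D s β ε hβpos A' B' h1 h2
          h3 h5 hmin h4 n hn he1 hε0.le
        exact ⟨(q, C), ⟨hq0, hqn, hC⟩, hCne, hc1.trans he2, by simp only; linarith⟩)
    refine ⟨q, hq0, C, (hP 1 one_pos).1, hC, ?_, ?_⟩
    · refine le_antisymm (le_of_forall_pos_le_add fun δ hδ => ?_) (hM.nonneg _)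
      simpa using (hP δ hδ).2.1
    · refine le_of_forall_pos_le_add fun δ hδ => ?_
      have := (hP δ hδ).2.2
      simp only at this
      linarith

/-- The set `D` is large, up to a periodic defect of size `t`. -/
def LargeSum (m : Set ℤ → ℝ) (s : ℝ) (t : ℕ) (D : Set ℤ) : Prop :=
  s ≤ m D ∨ ∃ q : ℕ, 0 < q ∧ ∃ C : Set ℤ, C.Nonempty ∧ PerSet q C ∧ m (C \ D) = 0 ∧
      s - t / q ≤ m C

open Pointwise in
lemma LargeSum.step (hm : m ∈ Set.extremePoints ℝ {m : Set ℤ → ℝ | IsMean Z m})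
    {s : ℝ} {t : ℕ} {D E D' : Set ℤ} (h : LargeSum m s t D) (hD : 0 < m D) (hE : 0 < m E)
    (hDE : ∀ a ∈ D, ∀ b ∈ E, a + b ∈ D') : LargeSum m (s + m E) (t + 1) D' := by
  have hM : IsMean Z m := hm.1
  rcases h with h | ⟨q, hq, C, hCne, hC, hCD, hsC⟩
  · rcases weak_kneser hm D' D E hDE hD hE with h1 | ⟨q, hq, C, h1, h2, h3, h4⟩
    · left; linarith
    · right
      refine ⟨q, hq, C, h1, h2, h3, ?_⟩
      have : (1:ℝ) / q ≤ ((t + 1 : ℕ) : ℝ) / q := by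
        gcongr; push_cast; linarith [Nat.cast_nonneg (α := ℝ) t]
      linarith
  · right
    have hqR : (0:ℝ) < q := by exact_mod_cast hq
    have hq' : (0:ℤ) < q := by exact_mod_cast hq
    have hper : PerSet q (C + E) := by
      intro x
      constructor
      · rintro ⟨c, hc, e, he, hx⟩
        refine ⟨c - q, ?_, e, he, by simp only at hx ⊢; linarith⟩
        have := hC (c - q)
        rw [← this]; simpa using hc
      · rintro ⟨c, hc, e, he, hx⟩
        exact ⟨c + q, (hC c).2 hc, e, he, by simp only at hx ⊢; linarith⟩
    have hnull : m ((C + E) \ D') = 0 := by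
      have hrep : ∀ r : ℕ, ∃ e ∈ E, ∀ x ∈ C + E, (q:ℤ) ∣ x - r → x - e ∈ C := by
        intro r
        by_cases hr : (r:ℤ) ∈ C + E
        · obtain ⟨c, hc, e, he, hx⟩ := hr
          refine ⟨e, he, fun x _ hd => ?_⟩
          have hx : c + e = r := hx
          have : (q:ℤ) ∣ (x - e) - c := by rwa [show x - e - c = x - r by linarith]
          exact (hC.of_dvd this).2 hc
        · obtain ⟨e, he⟩ := hM.nonempty_of_pos hE
          exact ⟨e, he, fun x hx hd => absurd ((hper.of_dvd hd).1 hx) hr⟩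
      choose e he hrep using hrep
      have hsub : (C + E) \ D' ⊆ ⋃ r ∈ Finset.range q, shiftSet (-e r) (C \ D) := by
        rintro x ⟨hx, hx'⟩
        simp only [Set.mem_iUnion, Finset.mem_range, exists_prop]
        have h0 := Int.emod_nonneg x hq'.ne'
        have h1 := Int.emod_lt_of_pos x hq'
        refine ⟨(x % q).toNat, by omega, ?_, fun hd => hx' ?_⟩
        · apply hrep _ x hx
          rw [Int.toNat_of_nonneg h0]
          exact Int.dvd_self_sub_emod
        · have := hDE _ hd _ (he (x % q).toNat)
          simpa using this
      refine le_antisymm (((hM.mono hsub).trans (hM.biUnion_le _ _)).trans ?_) (hM.nonneg _)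
      refine (Finset.sum_eq_zero fun r _ => ?_).le
      rw [hM.shift]; exact hCD
    have hCpos := hM.perSet_pos q hq hC hCne
    have ht0 := Nat.cast_nonneg (α := ℝ) t
    rcases weak_kneser hm (C + E) C E (fun a ha b hb => Set.add_mem_add ha hb) hCpos hE with
      h1 | ⟨q', hq', C', h1, h2, h3, h4⟩
    · refine ⟨q, hq, C + E, hCne.add (hM.nonempty_of_pos hE), hper, hnull, ?_⟩
      have : (t:ℝ) / q ≤ ((t + 1 : ℕ) : ℝ) / q := by
        gcongr; omega
      linarith
    · have hqR' : (0:ℝ) < q' := by exact_mod_cast hq'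
      have hsub : C' ⊆ C + E := by
        intro x hx
        by_contra hx'
        have hp : PerSet (q * q') (C' \ (C + E)) := by
          intro y
          have e1 : y + ((q * q' : ℕ) : ℤ) ∈ C' ↔ y ∈ C' := h2.of_dvd (by push_cast; simp)
          have e2 : y + ((q * q' : ℕ) : ℤ) ∈ C + E ↔ y ∈ C + E :=
            hper.of_dvd (by push_cast; simp)
          rw [Set.mem_sdiff, Set.mem_sdiff, e1, e2]
        have := hM.perSet_pos (q * q') (Nat.mul_pos hq hq') hp ⟨x, hx, hx'⟩
        linarith
      set g := Nat.gcd q q' with hg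
      have hgpos : 0 < g := Nat.gcd_pos_of_pos_left _ hq
      have hgR : (0:ℝ) < g := by exact_mod_cast hgpos
      refine ⟨g, hgpos, {x | ∃ k : ℤ, x + k * q ∈ C'}, ?_, ?_, ?_, ?_⟩
      · obtain ⟨x, hx⟩ := h1
        exact ⟨x, 0, by simpa using hx⟩
      · have hbez : (g:ℤ) = q * Nat.gcdA q q' + q' * Nat.gcdB q q' := Nat.gcd_eq_gcd_ab q q'
        intro x
        constructor
        · rintro ⟨k, hk⟩
          refine ⟨k + Nat.gcdA q q', ?_⟩
          refine (h2.of_dvd ?_).1 hk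
          refine ⟨Nat.gcdB q q', ?_⟩
          rw [hbez]; ring
        · rintro ⟨k, hk⟩
          refine ⟨k - Nat.gcdA q q', ?_⟩
          refine (h2.of_dvd ?_).2 hk
          refine ⟨Nat.gcdB q q', ?_⟩
          rw [hbez]; ring
      · refine le_antisymm ?_ (hM.nonneg _)
        rw [← hnull]
        apply hM.mono
        rintro x ⟨⟨k, hk⟩, hx'⟩
        exact ⟨(hper.mul x k).1 (hsub hk), hx'⟩
      · have h5 : m C' ≤ m {x | ∃ k : ℤ, x + k * q ∈ C'} :=
          hM.mono fun x hx => ⟨0, by simpa using hx⟩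
        have h6 : (t:ℝ) / q ≤ t / g := by
          gcongr; exact_mod_cast Nat.gcd_le_left _ hq
        have h7 : (1:ℝ) / q' ≤ 1 / g := by
          gcongr; exact_mod_cast Nat.gcd_le_right _ hq'
        have h8 : ((t + 1 : ℕ) : ℝ) / g = t / g + 1 / g := by push_cast; rw [add_div]
        linarith

end WK2

section FS

lemma mem_foldSum_zero (S : Set ℤ) (z : ℤ) : z ∈ foldSum 0 S ↔ z = 0 := by
  constructor
  · rintro ⟨f, -, rfl⟩; simp
  · rintro rfl; exact ⟨fun i => 0, fun i => i.elim0, by simp⟩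

lemma mem_foldSum_succ (n : ℕ) (S : Set ℤ) (z : ℤ) :
    z ∈ foldSum (n + 1) S ↔ ∃ u ∈ foldSum n S, ∃ b ∈ S, z = u + b := by
  constructor
  · rintro ⟨f, hf, rfl⟩
    exact ⟨_, ⟨fun i => f i.castSucc, fun i => hf _, rfl⟩, f (Fin.last n), hf _,
      Fin.sum_univ_castSucc f⟩
  · rintro ⟨u, ⟨f, hf, rfl⟩, b, hb, rfl⟩
    refine ⟨Fin.snoc (α := fun _ => ℤ) f b, ?_, ?_⟩
    · intro i
      refine Fin.lastCases ?_ (fun j => ?_) i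
      · simpa using hb
      · simpa using hf j
    · rw [Fin.sum_univ_castSucc]; simp

lemma foldSum_add {S : Set ℤ} {n k : ℕ} {u v : ℤ} (hu : u ∈ foldSum n S) (hv : v ∈ foldSum k S) :
    u + v ∈ foldSum (n + k) S := by
  induction k generalizing v with
  | zero => rw [(mem_foldSum_zero S v).1 hv]; simpa using hu
  | succ k ih =>
    obtain ⟨w, hw, b, hb, rfl⟩ := (mem_foldSum_succ _ _ _).1 hv
    exact (mem_foldSum_succ (n + k) _ _).2 ⟨u + w, ih hw, b, hb, by ring⟩

lemma foldSum_const {S : Set ℤ} {b : ℤ} (hb : b ∈ S) (k : ℕ) : (k : ℤ) * b ∈ foldSum k S :=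
  ⟨fun _ => b, fun _ => hb, by simp⟩

lemma foldSum_split (A B : Set ℤ) (a r : ℤ) (d : ℕ)
    (hAB : ∀ x ∈ A, x ∈ B ∨ ∃ i : ℕ, i ≤ d ∧ x = a + i * r) (h : ℕ) (N : ℤ)
    (hN : N ∈ foldSum h A) :
    ∃ j ≤ h, ∃ i ≤ (h - j) * d, ∃ u ∈ foldSum j B, N = u + ((h - j : ℕ) : ℤ) * a + i * r := by
  induction h generalizing N with
  | zero => exact ⟨0, le_rfl, 0, by simp, N, by
      rw [mem_foldSum_zero] at hN ⊢; exact hN, by simp⟩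
  | succ h ih =>
    obtain ⟨w, hw, x, hx, rfl⟩ := (mem_foldSum_succ _ _ _).1 hN
    obtain ⟨j, hj, i, hi, u, hu, rfl⟩ := ih w hw
    rcases hAB x hx with hx | ⟨i', hi', rfl⟩
    · refine ⟨j + 1, by omega, i, ?_, u + x, (mem_foldSum_succ _ _ _).2 ⟨u, hu, x, hx, rfl⟩, ?_⟩
      · rwa [Nat.add_sub_add_right]
      · rw [Nat.add_sub_add_right]; ring
    · have e : h + 1 - j = (h - j) + 1 := by omega
      refine ⟨j, by omega, i + i', ?_, u, hu, ?_⟩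
      · rw [e, add_mul]; omega
      · rw [e]; push_cast; ring

/-- Syndetic towards plus infinity. -/
def Synd (U : Set ℤ) : Prop :=
  ∃ K : ℤ, ∃ D0 : ℕ, ∀ y ≥ K, ∃ u ∈ U, y ≤ u ∧ u < y + D0

lemma not_synd_zero (B : Set ℤ) : ¬ Synd (foldSum 0 B) := by
  rintro ⟨K, D0, h⟩
  obtain ⟨u, hu, h1, h2⟩ := h (max K 1) (le_max_left _ _)
  rw [mem_foldSum_zero] at hu
  subst hu
  have := le_max_right K 1
  omega

lemma exists_abs_bound (s : Finset ℤ) : ∃ R : ℕ, ∀ x ∈ s, |x| ≤ R := by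
  refine ⟨∑ x ∈ s, x.natAbs, fun x hx => ?_⟩
  rw [Int.abs_eq_natAbs]
  exact_mod_cast Finset.single_le_sum (f := fun x : ℤ => x.natAbs) (fun _ _ => Nat.zero_le _) hx

/-- If all large integers lie in finitely many translates of `U`, then `U` is syndetic. -/
lemma synd_of_cover (U : Set ℤ) (s : Finset ℤ) (K : ℤ)
    (h : ∀ N ≥ K, ∃ t ∈ s, N - t ∈ U) : Synd U := by
  obtain ⟨R, hR⟩ := exists_abs_bound s
  refine ⟨K, 2 * R + 1, fun y hy => ?_⟩
  obtain ⟨t, ht, hu⟩ := h (y + R) (by omega)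
  have := abs_le.1 (hR t ht)
  exact ⟨_, hu, by omega, by push_cast; omega⟩

lemma synd_foldSum (A B : Set ℤ) (a r : ℤ) (d : ℕ)
    (hAB : ∀ x ∈ A, x ∈ B ∨ ∃ i : ℕ, i ≤ d ∧ x = a + i * r) (h : ℕ) (hrep : RepBy A h)
    (b : ℤ) (hb : b ∈ B) : Synd (foldSum h B) := by
  obtain ⟨K, hK⟩ := Filter.eventually_atTop.1 hrep
  refine synd_of_cover _ ((Finset.range (h + 1) ×ˢ Finset.range (h * d + 1)).image
    fun p : ℕ × ℕ => ((h - p.1 : ℕ) : ℤ) * a + p.2 * r - ((h - p.1 : ℕ) : ℤ) * b) K ?_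
  intro N hN
  obtain ⟨j, hj, i, hi, u, hu, rfl⟩ := foldSum_split A B a r d hAB h N (hK N hN)
  refine ⟨_, Finset.mem_image.2 ⟨(j, i), ?_, rfl⟩, ?_⟩
  · simp only [Finset.mem_product, Finset.mem_range]
    have : (h - j) * d ≤ h * d := Nat.mul_le_mul_right _ (by omega)
    omega
  · have := foldSum_add hu (foldSum_const hb (h - j))
    rw [Nat.add_sub_cancel' hj] at this
    convert this using 1
    ring

end FS

section PM

variable {Z : Set ℤ} {m : Set ℤ → ℝ}

lemma IsMean.Iio_zero (hm : IsMean Z m) (hZ : Set.Iio 0 ⊆ Z) (K : ℤ) : m (Set.Iio K) = 0 := by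
  have h0 : m (Set.Iio 0) = 0 := le_antisymm (hm.null ▸ hm.mono hZ) (hm.nonneg _)
  have : Set.Iio K = shiftSet (-K) (Set.Iio 0) := by
    ext x; simp [shiftSet]
  rw [this, hm.shift, h0]

lemma IsMean.synd_pos (hm : IsMean Z m) (hZ : Set.Iio 0 ⊆ Z) {U : Set ℤ} (hU : Synd U) :
    0 < m U := by
  obtain ⟨K, D0, h⟩ := hU
  have hsub : (Set.univ : Set ℤ) ⊆ Set.Iio K ∪ ⋃ e ∈ Finset.range D0, shiftSet (e : ℤ) U := by
    intro x _
    by_cases hx : x < K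
    · exact Or.inl hx
    · right
      obtain ⟨u, hu, h1, h2⟩ := h x (by omega)
      simp only [Set.mem_iUnion, Finset.mem_range]
      refine ⟨(u - x).toNat, by omega, ?_⟩
      show x + _ ∈ U
      rw [Int.toNat_of_nonneg (by omega)]
      simpa using hu
  have h1 := hm.mono hsub
  have h2 := hm.union_le (Set.Iio K) (⋃ e ∈ Finset.range D0, shiftSet (e : ℤ) U)
  have h3 := hm.biUnion_le (Finset.range D0) (fun e : ℕ => shiftSet (e : ℤ) U)
  rw [hm.univ] at h1
  rw [hm.Iio_zero hZ] at h2
  simp only [hm.shift, Finset.sum_const, nsmul_eq_mul] at h3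
  by_contra hneg
  have : m U = 0 := le_antisymm (not_lt.1 hneg) (hm.nonneg _)
  rw [this] at h3
  linarith

/-- Covering estimate. -/
lemma IsMean.cover_le (hm : IsMean Z m) (hZ : Set.Iio 0 ⊆ Z) (A B : Set ℤ) (a r : ℤ) (d : ℕ)
    (hAB : ∀ x ∈ A, x ∈ B ∨ ∃ i : ℕ, i ≤ d ∧ x = a + i * r) (h : ℕ) (hrep : RepBy A h) :
    1 ≤ ∑ j ∈ Finset.range (h + 1), (((h - j) * d + 1 : ℕ) : ℝ) * m (foldSum j B) := by
  obtain ⟨K, hK⟩ := Filter.eventually_atTop.1 hrep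
  have hsub : (Set.univ : Set ℤ) ⊆ Set.Iio K ∪ ⋃ j ∈ Finset.range (h + 1),
      ⋃ i ∈ Finset.range ((h - j) * d + 1),
        shiftSet (-(((h - j : ℕ) : ℤ) * a + i * r)) (foldSum j B) := by
    intro x _
    by_cases hx : x < K
    · exact Or.inl hx
    · right
      obtain ⟨j, hj, i, hi, u, hu, rfl⟩ := foldSum_split A B a r d hAB h x (hK x (by omega))
      simp only [Set.mem_iUnion, Finset.mem_range]
      refine ⟨j, by omega, i, by omega, ?_⟩
      show _ + _ ∈ foldSum j B
      convert hu using 1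
      ring
  have h1 := hm.mono hsub
  have h2 := hm.union_le (Set.Iio K) (⋃ j ∈ Finset.range (h + 1),
      ⋃ i ∈ Finset.range ((h - j) * d + 1),
        shiftSet (-(((h - j : ℕ) : ℤ) * a + i * r)) (foldSum j B))
  rw [hm.univ] at h1
  rw [hm.Iio_zero hZ] at h2
  refine (h1.trans h2).trans ?_
  rw [zero_add]
  refine (hm.biUnion_le _ _).trans (Finset.sum_le_sum fun j _ => ?_)
  refine (hm.biUnion_le _ _).trans ?_
  simp only [hm.shift, Finset.sum_const, nsmul_eq_mul, Finset.card_range]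
  exact le_rfl

lemma largeSum_multiset (hm : m ∈ Set.extremePoints ℝ {m : Set ℤ → ℝ | IsMean Z m})
    (B : Set ℤ) (j0 : ℕ) (hpos : ∀ j ≥ j0, 0 < m (foldSum j B)) (j : ℕ) (hj : j0 ≤ j)
    (l : Multiset ℕ) (hl : ∀ i ∈ l, j0 ≤ i) :
    LargeSum m (m (foldSum j B) + (l.map fun i => m (foldSum i B)).sum) l.card
      (foldSum (j + l.sum) B) := by
  induction l using Multiset.induction_on with
  | empty => left; simp
  | cons i l ih =>
    have h1 := ih fun i hi => hl i (Multiset.mem_cons_of_mem hi)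
    have h2 := h1.step hm (hpos _ (by omega)) (hpos i (hl i (Multiset.mem_cons_self _ _)))
      (D' := foldSum (j + (i ::ₘ l).sum) B) (fun a ha b hb => by
        have := foldSum_add ha hb
        rw [Multiset.sum_cons]
        convert this using 2
        ring)
    rw [Multiset.map_cons, Multiset.sum_cons, Multiset.card_cons]
    convert h2 using 1
    ring

end PM

section RES

open Classical in
/-- Residues of the `i`-fold sumset modulo `q`. -/
noncomputable def resSet (q : ℕ) [NeZero q] (U : Set ℤ) : Finset (ZMod q) :=
  Finset.univ.filter fun ρ => ∃ u ∈ U, (u : ZMod q) = ρ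

lemma mem_resSet (q : ℕ) [NeZero q] (U : Set ℤ) (ρ : ZMod q) :
    ρ ∈ resSet q U ↔ ∃ u ∈ U, (u : ZMod q) = ρ := by
  simp [resSet]

lemma resSet_univ (q : ℕ) [NeZero q] (U : Set ℤ) (hU : ∀ᶠ N : ℤ in atTop, N ∈ U) :
    resSet q U = Finset.univ := by
  obtain ⟨K, hK⟩ := Filter.eventually_atTop.1 hU
  ext ρ
  simp only [Finset.mem_univ, iff_true, mem_resSet]
  have hq : (1:ℤ) ≤ q := by exact_mod_cast Nat.one_le_iff_ne_zero.2 (NeZero.ne q)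
  refine ⟨(ρ.val : ℤ) + |K| * q, hK _ ?_, ?_⟩
  · nlinarith [le_abs_self K, abs_nonneg K, Int.natCast_nonneg ρ.val]
  · push_cast; simp

lemma resSet_growth (q : ℕ) [NeZero q] (B : Set ℤ) (b : ℤ) (hb : b ∈ B) (g1 : ℕ)
    (hg : RepBy B g1) (i : ℕ) : min q (i + 1) ≤ (resSet q (foldSum i B)).card := by
  have hsub : ∀ i, (resSet q (foldSum i B)).image (fun ρ => ρ + (b : ZMod q)) ⊆
      resSet q (foldSum (i + 1) B) := by
    intro i ρ hρ
    obtain ⟨σ, hσ, rfl⟩ := Finset.mem_image.1 hρ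
    obtain ⟨u, hu, rfl⟩ := (mem_resSet _ _ _).1 hσ
    exact (mem_resSet _ _ _).2 ⟨u + b, (mem_foldSum_succ _ _ _).2 ⟨u, hu, b, hb, rfl⟩,
      by push_cast; rfl⟩
  have hcard : ∀ i, ((resSet q (foldSum i B)).image (fun ρ => ρ + (b : ZMod q))).card =
      (resSet q (foldSum i B)).card := fun i =>
    Finset.card_image_of_injective _ (add_left_injective _)
  have hstab : ∀ i, (resSet q (foldSum (i + 1) B)).card ≤ (resSet q (foldSum i B)).card →
      resSet q (foldSum i B) = Finset.univ := by
    intro i hi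
    have heq : (resSet q (foldSum i B)).image (fun ρ => ρ + (b : ZMod q)) =
        resSet q (foldSum (i + 1) B) := Finset.eq_of_subset_of_card_le (hsub i) (by rw [hcard]; exact hi)
    have hk : ∀ k : ℕ, ∀ ρ ∈ resSet q (foldSum (i + k) B),
        ρ - k * (b : ZMod q) ∈ resSet q (foldSum i B) := by
      intro k
      induction k with
      | zero => intro ρ hρ; simpa using hρ
      | succ k ih =>
        intro ρ hρ
        obtain ⟨w, hw, rfl⟩ := (mem_resSet _ _ _).1 hρ
        obtain ⟨u, hu, x, hx, rfl⟩ := (mem_foldSum_succ (i + k) _ _).1 hw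
        have h1 := ih (u : ZMod q) ((mem_resSet _ _ _).2 ⟨u, hu, rfl⟩)
        obtain ⟨v, hv, hv'⟩ := (mem_resSet _ _ _).1 h1
        have h2 : ((v + x : ℤ) : ZMod q) ∈ resSet q (foldSum (i + 1) B) :=
          (mem_resSet _ _ _).2 ⟨v + x, (mem_foldSum_succ _ _ _).2 ⟨v, hv, x, hx, rfl⟩, rfl⟩
        rw [← heq] at h2
        obtain ⟨σ, hσ, hσ'⟩ := Finset.mem_image.1 h2
        convert hσ using 1
        push_cast at hσ' ⊢
        rw [hv'] at hσ'
        linear_combination -hσ'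
    have hall : resSet q (foldSum (i + g1) B) = Finset.univ := by
      have h0 := resSet_univ q _ hg
      ext ρ
      simp only [Finset.mem_univ, iff_true]
      have h1 : ρ - ((i * b : ℤ) : ZMod q) ∈ resSet q (foldSum g1 B) := by rw [h0]; simp
      obtain ⟨u, hu, hu'⟩ := (mem_resSet _ _ _).1 h1
      refine (mem_resSet _ _ _).2 ⟨i * b + u, foldSum_add (foldSum_const hb i) hu, ?_⟩
      push_cast at hu' ⊢
      rw [hu']; ring
    ext ρ
    simp only [Finset.mem_univ, iff_true]
    have := hk g1 (ρ + g1 * (b : ZMod q)) (by rw [hall]; simp)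
    simpa using this
  induction i with
  | zero =>
    refine (min_le_right _ _).trans ?_
    exact Finset.card_pos.2 ⟨0, (mem_resSet _ _ _).2 ⟨0, (mem_foldSum_zero _ _).2 rfl, by simp⟩⟩
  | succ i ih =>
    have hmono : (resSet q (foldSum i B)).card ≤ (resSet q (foldSum (i + 1) B)).card := by
      rw [← hcard]; exact Finset.card_le_card (hsub i)
    by_cases hi : (resSet q (foldSum (i + 1) B)).card ≤ (resSet q (foldSum i B)).card
    · have := hstab i hi
      rw [this, Finset.card_univ, ZMod.card] at hmono
      exact (min_le_left _ _).trans hmono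
    · have h3 := min_le_left q (i + 1 + 1)
      have h4 := min_le_right q (i + 1 + 1)
      rcases min_choice q (i + 1) with h | h <;> omega

variable {Z : Set ℤ} {m : Set ℤ → ℝ}

lemma PerSet.mem_of_res {q : ℕ} [NeZero q] {C : Set ℤ} (hC : PerSet q C) {x : ℤ}
    (hx : (x : ZMod q) ∈ resSet q C) : x ∈ C := by
  obtain ⟨u, hu, h⟩ := (mem_resSet _ _ _).1 hx
  refine (hC.of_dvd ?_).1 hu
  rw [← ZMod.intCast_zmod_eq_zero_iff_dvd]
  push_cast
  rw [h]; ring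

lemma IsMean.le_resSet (hm : IsMean Z m) {q : ℕ} [NeZero q] (C : Set ℤ) :
    q * m C ≤ (resSet q C).card := by
  have hq : 0 < q := Nat.pos_of_ne_zero (NeZero.ne q)
  have hsub : C ⊆ ⋃ ρ ∈ resSet q C, {x : ℤ | (q : ℤ) ∣ x - (ρ.val : ℤ)} := by
    intro x hx
    simp only [Set.mem_iUnion]
    refine ⟨(x : ZMod q), (mem_resSet _ _ _).2 ⟨x, hx, rfl⟩, ?_⟩
    show (q:ℤ) ∣ _
    rw [← ZMod.intCast_zmod_eq_zero_iff_dvd]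
    push_cast
    simp
  have h1 := (hm.mono hsub).trans (hm.biUnion_le _ _)
  simp only [hm.class_le q hq, Finset.sum_const, nsmul_eq_mul] at h1
  have hqR : (0:ℝ) < q := by exact_mod_cast hq
  calc q * m C ≤ q * ((resSet q C).card * (1 / q)) := by gcongr
    _ = _ := by field_simp

/-- Sets null for the mean are avoided by arbitrarily long intervals. -/
lemma IsMean.exists_gap (hm : IsMean Z m) {U : Set ℤ} (hU : m U = 0) (L : ℕ) :
    ∃ x : ℤ, ∀ y, x ≤ y → y < x + L → y ∉ U := by
  by_contra hcon
  push Not at hcon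
  have hsub : (Set.univ : Set ℤ) ⊆ ⋃ e ∈ Finset.range L, shiftSet (e : ℤ) U := by
    intro x _
    obtain ⟨y, h1, h2, hy⟩ := hcon x
    simp only [Set.mem_iUnion, Finset.mem_range]
    refine ⟨(y - x).toNat, by omega, ?_⟩
    show x + _ ∈ U
    rw [Int.toNat_of_nonneg (by omega)]
    simpa using hy
  have h1 := (hm.mono hsub).trans (hm.biUnion_le _ _)
  simp only [hm.shift, hU, hm.univ, Finset.sum_const_zero] at h1
  linarith

lemma final_rep (hm : IsMean Z m) (B : Set ℤ) (b : ℤ) (hb : b ∈ B) (g1 : ℕ)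
    (hg : RepBy B g1) (j0 M t : ℕ) (hsynd : Synd (foldSum j0 B))
    (hL : LargeSum m 1 t (foldSum M B)) : RepBy B (M + j0 + t) := by
  have hex : ∃ q : ℕ, 0 < q ∧ ∃ C : Set ℤ, C.Nonempty ∧ PerSet q C ∧ m (C \ foldSum M B) = 0 ∧
      1 - (t:ℝ) / q ≤ m C := by
    rcases hL with h | h
    · refine ⟨1, one_pos, Set.univ, Set.univ_nonempty, fun x => by simp, ?_, ?_⟩
      · have h1 := hm.inter_diff Set.univ (foldSum M B)
        rw [Set.univ_inter, hm.univ] at h1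
        linarith [hm.nonneg (Set.univ \ foldSum M B)]
      · rw [hm.univ]
        simp
    · exact h
  obtain ⟨q, hq, C, hCne, hC, hnull, hmC⟩ := hex
  have : NeZero q := ⟨hq.ne'⟩
  have hqR : (0:ℝ) < q := by exact_mod_cast hq
  have hc1 : q ≤ (resSet q C).card + t := by
    have h1 := hm.le_resSet (q := q) C
    have h2 : (q:ℝ) * (1 - (t:ℝ) / q) ≤ q * m C := by gcongr
    have h3 : (q:ℝ) * (1 - (t:ℝ) / q) = q - t := by field_simp
    have : (q:ℝ) ≤ (resSet q C).card + t := by linarith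
    exact_mod_cast this
  have hc2 : 1 ≤ (resSet q C).card := by
    obtain ⟨x, hx⟩ := hCne
    exact Finset.card_pos.2 ⟨_, (mem_resSet _ _ _).2 ⟨x, hx, rfl⟩⟩
  have hc3 := resSet_growth q B b hb g1 hg t
  have hrep : ∀ ρ : ZMod q, ∃ β : ℤ, ρ ∈ resSet q (foldSum t B) →
      β ∈ foldSum t B ∧ (β : ZMod q) = ρ := by
    intro ρ
    by_cases h : ρ ∈ resSet q (foldSum t B)
    · obtain ⟨u, hu, h'⟩ := (mem_resSet _ _ _).1 h
      exact ⟨u, fun _ => ⟨hu, h'⟩⟩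
    · exact ⟨0, fun h' => absurd h' h⟩
  choose β hβ using hrep
  obtain ⟨R, hR⟩ := exists_abs_bound (Finset.univ.image β)
  obtain ⟨K, D0, hS⟩ := hsynd
  obtain ⟨x, hx⟩ := hm.exists_gap hnull (D0 + 2 * R + 1)
  refine Filter.eventually_atTop.2 ⟨K + x + R + D0, fun N hN => ?_⟩
  obtain ⟨y, hy, hy1, hy2⟩ := hS (N - x - R - D0) (by omega)
  -- pigeonhole
  have hpig : ∃ ρ ∈ resSet q (foldSum t B), ((N - y : ℤ) : ZMod q) - ρ ∈ resSet q C := by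
    by_contra hcon
    push Not at hcon
    have hdis : Disjoint ((resSet q (foldSum t B)).image fun ρ => ((N - y : ℤ) : ZMod q) - ρ)
        (resSet q C) := by
      rw [Finset.disjoint_left]
      intro σ hσ
      obtain ⟨ρ, hρ, rfl⟩ := Finset.mem_image.1 hσ
      exact hcon ρ hρ
    have h1 := Finset.card_le_univ (((resSet q (foldSum t B)).image
      fun ρ => ((N - y : ℤ) : ZMod q) - ρ) ∪ resSet q C)
    rw [Finset.card_union_of_disjoint hdis, ZMod.card,
      Finset.card_image_of_injective _ sub_right_injective] at h1
    rcases min_choice q (t + 1) with h | h <;> omega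
  obtain ⟨ρ, hρ, hρC⟩ := hpig
  obtain ⟨hβ1, hβ2⟩ := hβ ρ hρ
  have hR' := abs_le.1 (hR (β ρ) (Finset.mem_image_of_mem _ (Finset.mem_univ _)))
  have hmem : N - y - β ρ ∈ C := by
    apply hC.mem_of_res
    rw [← hβ2] at hρC
    push_cast at hρC ⊢
    exact hρC
  have hD : N - y - β ρ ∈ foldSum M B := by
    by_contra hD
    exact hx _ (by omega) (by push_cast; omega) ⟨hmem, hD⟩
  have := foldSum_add (foldSum_add hD hy) hβ1
  convert this using 1
  ring

end RES

lemma LargeSum.mono {m : Set ℤ → ℝ} {s s' : ℝ} {t : ℕ} {D : Set ℤ} (h : LargeSum m s t D)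
    (hs : s' ≤ s) : LargeSum m s' t D := by
  rcases h with h | ⟨q, hq, C, h1, h2, h3, h4⟩
  · exact Or.inl (hs.trans h)
  · exact Or.inr ⟨q, hq, C, h1, h2, h3, by linarith⟩

lemma sum_closed (h d n : ℕ) (hn : n ≤ h) :
    6 * ∑ j ∈ Finset.range n, ((j : ℤ) + 1) * (((h - j) * d + 1 : ℕ) : ℤ) =
      3 * n * (n + 1) + d * (n * (n + 1) * (3 * h - 2 * n + 2)) := by
  induction n with
  | zero => simp
  | succ n ih =>
    rw [Finset.sum_range_succ, mul_add, ih (by omega)]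
    push_cast [Nat.cast_sub (show n ≤ h by omega)]
    ring

lemma sum_lower (h d n : ℕ) (hn : 1 ≤ n) :
    h * d + n ≤ ∑ j ∈ Finset.range n, (j + 1) * ((h - j) * d + 1) := by
  induction n, hn using Nat.le_induction with
  | base => simp
  | succ n hn ih =>
    rw [Finset.sum_range_succ]
    have : 1 ≤ (n + 1) * ((h - n) * d + 1) := Nat.mul_pos (by omega) (by omega)
    omega

lemma arith_bound (h d j0 g : ℕ) (hj : 1 ≤ j0) (hjh : j0 ≤ h)
    (hg : g = h + ∑ j ∈ Finset.Ico j0 h, (j + 1) * ((h - j) * d + 1) + j0) :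
    g ≤ h * (h + 3) / 2 + d * (h * (h - 1) * (h + 4)) / 6 := by
  have h1 := sum_lower h d j0 hj
  have h2 := Finset.sum_range_add_sum_Ico (fun j => (j + 1) * ((h - j) * d + 1)) hjh
  have h3 := sum_closed h d h le_rfl
  have h4 : 6 * (∑ j ∈ Finset.range h, (j + 1) * ((h - j) * d + 1)) =
      3 * h * (h + 1) + d * (h * (h + 1) * (h + 2)) := by
    zify
    have e : (3 * (h:ℤ) - 2 * h + 2) = h + 2 := by ring
    rw [e] at h3
    rw [← h3]
    push_cast
    rfl
  have h5 : g + h * d ≤ h + ∑ j ∈ Finset.range h, (j + 1) * ((h - j) * d + 1) := by omega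
  have h6 : 6 * g ≤ 3 * (h * (h + 3)) + d * (h * (h - 1) * (h + 4)) := by
    obtain ⟨k, rfl⟩ : ∃ k, h = k + 1 := ⟨h - 1, by omega⟩
    simp only [Nat.add_sub_cancel]
    nlinarith
  have e1 : h * (h + 3) / 2 * 2 = h * (h + 3) := Nat.div_mul_cancel (by
    rcases Nat.even_or_odd h with he | ho
    · exact (he.mul_right _).two_dvd
    · exact ((ho.add_odd (by decide)).mul_left _).two_dvd)
  have h7 : 6 * (g - h * (h + 3) / 2) ≤ d * (h * (h - 1) * (h + 4)) := by omega
  have := (Nat.le_div_iff_mul_le (by norm_num : 0 < 6)).2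
    ((mul_comm 6 (g - h * (h + 3) / 2)) ▸ h7)
  omega

/-- Main argument. -/
lemma main_rep (A B : Set ℤ) (a r : ℤ) (d : ℕ)
    (hAB : ∀ x ∈ A, x ∈ B ∨ ∃ i : ℕ, i ≤ d ∧ x = a + i * r) (h : ℕ) (hrep : RepBy A h)
    (b : ℤ) (hb : b ∈ B) (g1 : ℕ) (hg : RepBy B g1) :
    ∃ g, 1 ≤ g ∧ RepBy B g ∧ g ≤ h * (h + 3) / 2 + d * (h * (h - 1) * (h + 4)) / 6 := by
  classical
  have hS := synd_foldSum A B a r d hAB h hrep b hb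
  have hex : ∃ j, Synd (foldSum j B) := ⟨h, hS⟩
  obtain ⟨j0, hj0, hmin⟩ : ∃ j0, Synd (foldSum j0 B) ∧ ∀ j < j0, ¬ Synd (foldSum j B) :=
    ⟨Nat.find hex, Nat.find_spec hex, fun j hj => Nat.find_min hex hj⟩
  have hj0h : j0 ≤ h := by
    by_contra hc
    exact hmin h (by omega) hS
  have hj01 : 1 ≤ j0 := by
    by_contra hc
    obtain rfl : j0 = 0 := by omega
    exact not_synd_zero B hj0
  have hZ : ∀ L : ℕ, ∃ y : ℤ, ∀ u ∈ foldSum (j0 - 1) B ∪ Set.Iio 0, ¬ (y ≤ u ∧ u < y + L) := by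
    intro L
    by_contra hcon
    push Not at hcon
    refine hmin (j0 - 1) (by omega) ⟨0, L, fun y hy => ?_⟩
    obtain ⟨u, hu, h1, h2⟩ := hcon y
    rcases hu with hu | hu
    · exact ⟨u, hu, h1, h2⟩
    · have : u < 0 := hu
      omega
  obtain ⟨m, hm⟩ := exists_extreme _ (exists_mean _ hZ)
  have hM : IsMean (foldSum (j0 - 1) B ∪ Set.Iio 0) m := hm.1
  have hIio : Set.Iio 0 ⊆ foldSum (j0 - 1) B ∪ Set.Iio 0 := Set.subset_union_right
  have hzero : ∀ j < j0, m (foldSum j B) = 0 := by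
    intro j hj
    refine le_antisymm ?_ (hM.nonneg _)
    rw [← hM.null, ← hM.shift (((j0 - 1 - j : ℕ) : ℤ) * b) (foldSum (j0 - 1) B ∪ Set.Iio 0)]
    apply hM.mono
    intro x hx
    have := foldSum_add hx (foldSum_const hb (j0 - 1 - j))
    rw [show j + (j0 - 1 - j) = j0 - 1 by omega] at this
    exact Or.inl this
  have hpos0 := hM.synd_pos hIio hj0
  have hpos : ∀ j ≥ j0, 0 < m (foldSum j B) := by
    intro j hj
    refine hpos0.trans_le ?_
    rw [← hM.shift (((j - j0 : ℕ) : ℤ) * b) (foldSum j B)]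
    apply hM.mono
    intro x hx
    have := foldSum_add hx (foldSum_const hb (j - j0))
    rw [show j0 + (j - j0) = j by omega] at this
    exact this
  have hcov := hM.cover_le hIio A B a r d hAB h hrep
  rw [Finset.sum_range_succ, ← Finset.sum_range_add_sum_Ico _ hj0h,
    Finset.sum_eq_zero (fun j hj => by
      rw [hzero j (Finset.mem_range.1 hj), mul_zero])] at hcov
  have hlarge := largeSum_multiset hm B j0 hpos h hj0h
    (∑ j ∈ Finset.Ico j0 h, Multiset.replicate ((h - j) * d + 1) j) (by
      intro i hi
      obtain ⟨j, hj, hij⟩ := Multiset.mem_sum.1 hi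
      rw [Multiset.eq_of_mem_replicate hij]
      exact (Finset.mem_Ico.1 hj).1)
  have e1 : (∑ j ∈ Finset.Ico j0 h, Multiset.replicate ((h - j) * d + 1) j).card =
      ∑ j ∈ Finset.Ico j0 h, ((h - j) * d + 1) := by
    simp [Multiset.card_sum]
  have e2 : (∑ j ∈ Finset.Ico j0 h, Multiset.replicate ((h - j) * d + 1) j).sum =
      ∑ j ∈ Finset.Ico j0 h, ((h - j) * d + 1) * j := by
    rw [← Multiset.coe_sumAddMonoidHom, map_sum]
    simp
    exact Finset.sum_congr rfl fun j _ => by ring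
  have e3 : ((∑ j ∈ Finset.Ico j0 h, Multiset.replicate ((h - j) * d + 1) j).map
      fun i => m (foldSum i B)).sum =
      ∑ j ∈ Finset.Ico j0 h, (((h - j) * d + 1 : ℕ) : ℝ) * m (foldSum j B) := by
    rw [← Multiset.coe_mapAddMonoidHom, ← Multiset.coe_sumAddMonoidHom, map_sum, map_sum]
    simp
    exact Finset.sum_congr rfl fun j _ => by ring
  rw [e1, e2, e3] at hlarge
  have hlarge' := hlarge.mono (s' := 1) (by simpa [add_comm] using hcov)
  refine ⟨_, ?_, final_rep hM B b hb g1 hg j0 _ _ hj0 hlarge', ?_⟩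
  · omega
  · refine arith_bound h d j0 _ hj01 hj0h ?_
    have : ∑ j ∈ Finset.Ico j0 h, (j + 1) * ((h - j) * d + 1) =
        ∑ j ∈ Finset.Ico j0 h, ((h - j) * d + 1) * j + ∑ j ∈ Finset.Ico j0 h, ((h - j) * d + 1) := by
      rw [← Finset.sum_add_distrib]
      exact Finset.sum_congr rfl fun j _ => by ring
    omega

end OB

theorem order_of_basis_minus_AP_le
    (A : Set ℤ) (h : ℕ) (hA : IsAdditiveBasis A) (hordA : basisOrder A = h)
    (X : Finset ℤ) (hXne : X.Nonempty) (hXA : ↑X ⊆ A) (hXAP : IsAPFinset X)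
    (hB : IsAdditiveBasis (A \ ↑X)) :
    basisOrder (A \ ↑X) ≤ h * (h + 3) / 2 + (X.card - 1) * (h * (h - 1) * (h + 4)) / 6 := by
  have hmem : basisOrder A ∈ {h : ℕ | 1 ≤ h ∧ RepBy A h} := Nat.sInf_mem hA.2
  rw [hordA] at hmem
  obtain ⟨g1, hg1, hg⟩ := hB.2
  obtain ⟨a, r, hr, hX⟩ := hXAP
  obtain ⟨b, hb⟩ : ∃ b, b ∈ A \ (↑X : Set ℤ) := by
    obtain ⟨N, f, hf, -⟩ := (Filter.Eventually.exists hg : ∃ N, N ∈ foldSum g1 _)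
    exact ⟨f ⟨0, hg1⟩, hf _⟩
  have hAB : ∀ x ∈ A, x ∈ A \ (↑X : Set ℤ) ∨ ∃ i : ℕ, i ≤ X.card - 1 ∧ x = a + i * r := by
    intro x hx
    by_cases hxX : x ∈ X
    · right
      rw [hX] at hxX
      obtain ⟨i, hi, rfl⟩ := Finset.mem_image.1 hxX
      exact ⟨i, by have := Finset.mem_range.1 hi; omega, rfl⟩
    · exact Or.inl ⟨hx, by simpa using hxX⟩
  obtain ⟨g, h1, h2, h3⟩ := main_rep A _ a r (X.card - 1) hAB h hmem.2 b hb g1 hg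
  exact (Nat.sInf_le (show g ∈ {h : ℕ | 1 ≤ h ∧ RepBy (A \ ↑X) h} from ⟨h1, h2⟩)).trans h3
end
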